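/- arXiv:2407.18717 — 3 statements merged into one kernel-verified Lean document; each statement's English description precedes it below -/
import Mathlib

section
/- Let C_a > 0, θ ≥ 0 and let g : 𝕋 → ℝ be continuous; set a := C_a + θg and assume a is even (a(−x) = a(x)) and a(x) > 0 for all x ∈ 𝕋. Let v̄ ≠ 0 and let (ρ, j) be a classical solution of the reduced Cucker–Smale PDE with kernel a and parameter v̄ on [0,∞), satisfying ∫_𝕋 ρ(x,0) dx = 1 and ∫_𝕋 j(x,0) dx = v̄. Define K := ( 2(v̄²‖ρ(·,0)‖² + ‖j(·,0)‖²)/v̄² + 18‖j(·,0) − v̄ρ(·,0)‖²/v̄² )^{1/2} and assume 4θ‖g‖K < C_a. Then ‖ρ(·,t)‖ ≤ K for all t ≥ 0, and ‖j(·,t) − v̄ρ(·,t)‖² ≤ e^{−C_a t} ‖j(·,0) − v̄ρ(·,0)‖² for all t ≥ 0. -/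
open Real MeasureTheory

/-- Convolution on the torus `ℝ/2πℤ`, with functions represented as `2π`-periodic
functions on `ℝ` and the integral taken over one period. -/
noncomputable def conv1 (f h : ℝ → ℝ) (x : ℝ) : ℝ :=
  ∫ y in (0:ℝ)..(2*π), f (x - y) * h y

/-- `L²(𝕋)` inner product. -/
noncomputable def ip (f h : ℝ → ℝ) : ℝ :=
  ∫ x in (0:ℝ)..(2*π), f x * h x

/-- `L²(𝕋)` norm. -/
noncomputable def nrm (f : ℝ → ℝ) : ℝ := Real.sqrt (ip f f)

/-- A classical solution of the reduced Cucker-Smale PDE with kernel `a` and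
parameter `vbar` on the time interval `I`:  smooth `2π`-periodic-in-`x` functions
`ρ, j` satisfying `∂ₜρ = −∂ₓj` and `∂ₜj = ρ(a∗j) − j(a∗ρ) − vbar²∂ₓρ` pointwise. -/
structure IsClassicalSol (a : ℝ → ℝ) (vbar : ℝ) (ρ j : ℝ → ℝ → ℝ) (I : Set ℝ) : Prop where
  periodic_rho : ∀ t ∈ I, Function.Periodic (fun x => ρ x t) (2*π)
  periodic_j : ∀ t ∈ I, Function.Periodic (fun x => j x t) (2*π)
  smooth_rho : ContDiffOn ℝ (⊤ : ℕ∞) (fun p : ℝ × ℝ => ρ p.1 p.2) (Set.univ ×ˢ I)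
  smooth_j : ContDiffOn ℝ (⊤ : ℕ∞) (fun p : ℝ × ℝ => j p.1 p.2) (Set.univ ×ˢ I)
  pde_rho : ∀ (x : ℝ), ∀ t ∈ I,
    derivWithin (fun s => ρ x s) I t = - deriv (fun y => j y t) x
  pde_j : ∀ (x : ℝ), ∀ t ∈ I,
    derivWithin (fun s => j x s) I t =
      ρ x t * conv1 a (fun y => j y t) x - j x t * conv1 a (fun y => ρ y t) x
        - vbar ^ 2 * deriv (fun y => ρ y t) x

section helpers

lemma two_pi_nn : (0:ℝ) ≤ 2*π := by positivity

lemma ip_self_nonneg (f : ℝ → ℝ) : 0 ≤ ip f f :=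
  intervalIntegral.integral_nonneg two_pi_nn (fun x _ => mul_self_nonneg _)

lemma nrm_nonneg (f : ℝ → ℝ) : 0 ≤ nrm f := Real.sqrt_nonneg _

lemma nrm_sq (f : ℝ → ℝ) : nrm f ^ 2 = ip f f := Real.sq_sqrt (ip_self_nonneg f)

lemma ip_cs (f h : ℝ → ℝ) (hf : Continuous f) (hh : Continuous h) :
    |ip f h| ≤ nrm f * nrm h := by
  have key : ∀ x : ℝ, 0 ≤ ip f f * (x * x) + (2 * ip f h) * x + ip h h := by
    intro x
    have h0 := ip_self_nonneg (fun y => x * f y + h y)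
    have : ip (fun y => x * f y + h y) (fun y => x * f y + h y)
        = ip f f * (x * x) + (2 * ip f h) * x + ip h h := by
      unfold ip
      have e : ∀ y, (x * f y + h y) * (x * f y + h y)
        = (x*x) * (f y * f y) + (2*x) * (f y * h y) + h y * h y := fun y => by ring
      simp_rw [e]
      rw [intervalIntegral.integral_add, intervalIntegral.integral_add,
        intervalIntegral.integral_const_mul, intervalIntegral.integral_const_mul]
      · ring
      all_goals exact Continuous.intervalIntegrable (by fun_prop) _ _
    linarith
  have hd := discrim_le_zero key
  unfold discrim at hd
  refine abs_le_of_sq_le_sq ?_ (mul_nonneg (nrm_nonneg _) (nrm_nonneg _))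
  rw [mul_pow, nrm_sq, nrm_sq]
  nlinarith

lemma tri_bound (f h w : ℝ → ℝ) (hf : Continuous f) (hh : Continuous h) (hw : Continuous w)
    (M : ℝ) (hM : ∀ x, |w x| ≤ M) :
    |∫ x in (0:ℝ)..(2*π), f x * (h x * w x)| ≤ M * nrm f * nrm h := by
  have hM0 : 0 ≤ M := (abs_nonneg _).trans (hM 0)
  have h1 := ip_cs f (fun x => h x * w x) hf (hh.mul hw)
  have h2 : nrm (fun x => h x * w x) ≤ M * nrm h := by
    apply le_of_sq_le_sq _ (mul_nonneg hM0 (nrm_nonneg _)) 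
    rw [mul_pow, nrm_sq, nrm_sq]
    unfold ip
    rw [← intervalIntegral.integral_const_mul]
    apply intervalIntegral.integral_mono_on two_pi_nn
    · exact Continuous.intervalIntegrable (by fun_prop) _ _
    · exact Continuous.intervalIntegrable (by fun_prop) _ _
    · intro x _
      have : w x ^ 2 ≤ M ^ 2 := sq_le_sq' (abs_le.mp (hM x)).1 (abs_le.mp (hM x)).2
      nlinarith [mul_le_mul_of_nonneg_right this (sq_nonneg (h x))]
  calc _ ≤ nrm f * nrm (fun x => h x * w x) := h1
    _ ≤ nrm f * (M * nrm h) := mul_le_mul_of_nonneg_left h2 (nrm_nonneg _)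
    _ = _ := by ring

lemma conv1_cont (g h : ℝ → ℝ) (hg : Continuous g) (hh : Continuous h) :
    Continuous (conv1 g h) := by
  unfold conv1
  apply intervalIntegral.continuous_parametric_intervalIntegral_of_continuous'
  fun_prop

lemma conv1_bound (g h : ℝ → ℝ) (hg : Continuous g) (hh : Continuous h)
    (hp : Function.Periodic g (2*π)) (x : ℝ) : |conv1 g h x| ≤ nrm g * nrm h := by
  have h1 := ip_cs (fun y => g (x - y)) h (by fun_prop) hh
  have h2 : nrm (fun y => g (x - y)) = nrm g := by
    unfold nrm ip
    congr 1
    have hp2 : Function.Periodic (fun y => g y * g y) (2*π) := fun y => by simp [hp y]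
    have := hp2.intervalIntegral_add_eq (x - 2*π) 0
    rw [intervalIntegral.integral_comp_sub_left (fun y => g y * g y) x]
    simpa using this
  rw [h2] at h1
  exact h1

lemma conv1_split (C θ : ℝ) (g h : ℝ → ℝ) (hg : Continuous g) (hh : Continuous h) (x : ℝ) :
    conv1 (fun x => C + θ * g x) h x = C * (∫ y in (0:ℝ)..(2*π), h y) + θ * conv1 g h x := by
  unfold conv1
  rw [← intervalIntegral.integral_const_mul, ← intervalIntegral.integral_const_mul,
    ← intervalIntegral.integral_add]
  · congr 1; ext y; ring
  all_goals exact Continuous.intervalIntegrable (by fun_prop) _ _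

lemma conv1_lin (a q r : ℝ → ℝ) (v : ℝ) (ha : Continuous a) (hq : Continuous q)
    (hr : Continuous r) (x : ℝ) :
    conv1 a (fun y => q y - v * r y) x = conv1 a q x - v * conv1 a r x := by
  unfold conv1
  rw [← intervalIntegral.integral_const_mul, ← intervalIntegral.integral_sub]
  · congr 1; ext y; ring
  all_goals exact Continuous.intervalIntegrable (by fun_prop) _ _

lemma conv1_symm (a q r : ℝ → ℝ) (ha : Continuous a) (hq : Continuous q)
    (hr : Continuous r) (hev : ∀ x, a (-x) = a x) :
    (∫ x in (0:ℝ)..(2*π), r x * conv1 a q x) = ∫ x in (0:ℝ)..(2*π), q x * conv1 a r x := by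
  unfold conv1
  simp_rw [← intervalIntegral.integral_const_mul]
  rw [intervalIntegral_intervalIntegral_swap]
  · congr 1; ext x; congr 1; ext y
    rw [← hev (y - x)]; ring_nf
  · apply IntegrableOn.mono_set (t := Set.uIcc 0 (2*π) ×ˢ Set.uIcc 0 (2*π))
    · apply ContinuousOn.integrableOn_compact (isCompact_uIcc.prod isCompact_uIcc)
      fun_prop
    · exact Set.prod_mono Set.uIoc_subset_uIcc Set.uIoc_subset_uIcc

/-- the static dissipation estimates -/
lemma static_est (C θ : ℝ) (hC : 0 < C) (hθ : 0 ≤ θ) (g q r : ℝ → ℝ) (hg : Continuous g)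
    (hp : Function.Periodic g (2*π)) (hq : Continuous q) (hr : Continuous r)
    (h0 : (∫ y in (0:ℝ)..(2*π), q y) = 0) (h1 : (∫ y in (0:ℝ)..(2*π), r y) = 1)
    (D : ℝ → ℝ) (hD : D = fun x => r x * conv1 (fun x => C + θ * g x) q x
      - q x * conv1 (fun x => C + θ * g x) r x) :
    (∫ x in (0:ℝ)..(2*π), q x * D x) ≤ -(C - 2 * θ * nrm g * nrm r) * nrm q ^ 2 ∧
    |∫ x in (0:ℝ)..(2*π), r x * D x| ≤
      2 * θ * nrm g * nrm q * nrm r ^ 2 + C * nrm r * nrm q := by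
  have hc1 := conv1_cont g q hg hq
  have hc2 := conv1_cont g r hg hr
  have hD' : D = fun x => θ * (r x * conv1 g q x) - C * q x - θ * (q x * conv1 g r x) := by
    rw [hD]; ext x
    rw [conv1_split C θ g q hg hq, conv1_split C θ g r hg hr, h0, h1]; ring
  have b1 := tri_bound q r (conv1 g q) hq hr hc1 _ (conv1_bound g q hg hq hp)
  have b2 := tri_bound q q (conv1 g r) hq hq hc2 _ (conv1_bound g r hg hr hp)
  have b3 := tri_bound r r (conv1 g q) hr hr hc1 _ (conv1_bound g q hg hq hp)
  have b4 := tri_bound r q (conv1 g r) hr hq hc2 _ (conv1_bound g r hg hr hp)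
  have b5 := ip_cs r q hr hq
  have e : ∀ u : ℝ → ℝ, Continuous u → (∫ x in (0:ℝ)..(2*π), u x * D x) =
      θ * (∫ x in (0:ℝ)..(2*π), u x * (r x * conv1 g q x)) - C * ip u q
       - θ * (∫ x in (0:ℝ)..(2*π), u x * (q x * conv1 g r x)) := by
    intro u hu
    rw [hD']
    unfold ip
    rw [← intervalIntegral.integral_const_mul, ← intervalIntegral.integral_const_mul,
      ← intervalIntegral.integral_const_mul, ← intervalIntegral.integral_sub,
      ← intervalIntegral.integral_sub]
    · congr 1; ext y; ring
    all_goals exact Continuous.intervalIntegrable (by fun_prop) _ _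
  rw [e q hq, e r hr, ← nrm_sq q]
  constructor
  · have := mul_le_mul_of_nonneg_left (abs_le.mp b1).2 hθ
    have := mul_le_mul_of_nonneg_left (abs_le.mp b2).1 hθ
    nlinarith
  · have c1 := mul_le_mul_of_nonneg_left (abs_le.mp b3).2 hθ
    have c2 := mul_le_mul_of_nonneg_left (abs_le.mp b3).1 hθ
    have c3 := mul_le_mul_of_nonneg_left (abs_le.mp b4).2 hθ
    have c4 := mul_le_mul_of_nonneg_left (abs_le.mp b4).1 hθ
    have c5 := mul_le_mul_of_nonneg_left (abs_le.mp b5).2 hC.le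
    have c6 := mul_le_mul_of_nonneg_left (abs_le.mp b5).1 hC.le
    rw [abs_le]; constructor <;> nlinarith

lemma int_deriv_zero (f : ℝ → ℝ) (hf : ContDiff ℝ 1 f) (hp : Function.Periodic f (2*π)) :
    (∫ x in (0:ℝ)..(2*π), deriv f x) = 0 := by
  rw [intervalIntegral.integral_deriv_eq_sub]
  · have := hp 0; simp at this; linarith
  · intro x _; exact hf.differentiable (by norm_num) x
  · exact (hf.continuous_deriv (by norm_num)).intervalIntegrable _ _

lemma int_cont (F : ℝ → ℝ → ℝ)
    (hF : ContinuousOn (fun p : ℝ × ℝ => F p.1 p.2) (Set.univ ×ˢ Set.Ici 0)) :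
    ContinuousOn (fun t => ∫ x in (0:ℝ)..(2*π), F x t) (Set.Ici 0) := by
  have h : Continuous (fun t => ∫ x in (0:ℝ)..(2*π), F x (max t 0)) := by
    apply intervalIntegral.continuous_parametric_intervalIntegral_of_continuous'
    have : Continuous (fun p : ℝ × ℝ => ((p.2, max p.1 0) : ℝ × ℝ)) := by fun_prop
    exact hF.comp_continuous this (fun p => by simp)
  refine h.continuousOn.congr ?_
  intro t ht
  simp [max_eq_left (Set.mem_Ici.mp ht)]

lemma int_deriv (F : ℝ → ℝ → ℝ)
    (hF : ContDiffOn ℝ 1 (fun p : ℝ × ℝ => F p.1 p.2) (Set.univ ×ˢ Set.Ici 0)) (t : ℝ)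
    (ht : 0 < t) :
    HasDerivAt (fun t => ∫ x in (0:ℝ)..(2*π), F x t)
      (∫ x in (0:ℝ)..(2*π), deriv (fun s => F x s) t) t := by
  set G := fun p : ℝ × ℝ => F p.1 p.2 with hG
  set U : Set (ℝ × ℝ) := Set.univ ×ˢ Set.Ioi 0 with hU
  have hUo : IsOpen U := isOpen_univ.prod isOpen_Ioi
  have hGU : ContDiffOn ℝ 1 G U := hF.mono (Set.prod_mono le_rfl Set.Ioi_subset_Ici_self)
  have hd : ContinuousOn (fun p => fderiv ℝ G p (0, 1)) U :=
    (hGU.continuousOn_fderiv_of_isOpen hUo le_rfl).clm_apply continuousOn_const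
  have hda : ∀ x s, 0 < s → HasDerivAt (fun s => F x s) (fderiv ℝ G (x, s) (0, 1)) s := by
    intro x s hs
    have h1 : HasFDerivAt G (fderiv ℝ G (x, s)) (x, s) :=
      ((hGU.contDiffAt (hUo.mem_nhds (show (x, s) ∈ U from ⟨trivial, hs⟩))).differentiableAt (by norm_num)).hasFDerivAt
    have h2 : HasDerivAt (fun s : ℝ => ((x, s) : ℝ × ℝ)) (0, 1) s :=
      (hasDerivAt_const s x).prodMk (hasDerivAt_id s)
    exact h1.comp_hasDerivAt s h2
  have hsl : ∀ s, 0 < s → ∀ (H : ℝ × ℝ → ℝ), ContinuousOn H U → Continuous (fun x => H (x, s)) :=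
    fun s hs H hH => hH.comp_continuous (by fun_prop) (fun x => ⟨trivial, hs⟩)
  have hcomp : IsCompact ((Set.Icc 0 (2*π)) ×ˢ (Set.Icc (t/2) (2*t)) : Set (ℝ × ℝ)) :=
    isCompact_Icc.prod isCompact_Icc
  obtain ⟨M, hM⟩ := hcomp.exists_bound_of_continuousOn (hd.mono (by
    rintro ⟨x, s⟩ ⟨_, hs⟩
    exact ⟨trivial, lt_of_lt_of_le (by positivity) hs.1⟩))
  have := (intervalIntegral.hasDerivAt_integral_of_dominated_loc_of_deriv_le (μ := volume)
    (F := fun s x => F x s) (F' := fun s x => fderiv ℝ G (x, s) (0, 1)) (x₀ := t)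
    (a := 0) (b := 2*π) (bound := fun _ => M)
    (s := Set.Icc (t/2) (2*t)) (Icc_mem_nhds (by linarith) (by linarith)) ?_ ?_ ?_ ?_ ?_ ?_).2
  · have e : (∫ x in (0:ℝ)..(2*π), deriv (fun s => F x s) t)
        = ∫ x in (0:ℝ)..(2*π), fderiv ℝ G (x, t) (0, 1) :=
      intervalIntegral.integral_congr (fun x _ => (hda x t ht).deriv)
    rw [e]
    exact this
  · filter_upwards [lt_mem_nhds ht] with s hs
    exact (hsl s hs G hGU.continuousOn).aestronglyMeasurable
  · exact (hsl t ht G hGU.continuousOn).intervalIntegrable _ _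
  · exact (hsl t ht _ hd).aestronglyMeasurable
  · refine Filter.Eventually.of_forall fun x hx s hs => hM (x, s) ⟨?_, hs⟩
    rw [Set.uIoc_of_le two_pi_nn] at hx
    exact Set.Ioc_subset_Icc_self hx
  · exact intervalIntegrable_const
  · refine Filter.Eventually.of_forall fun x hx s hs => hda x s ?_
    exact lt_of_lt_of_le (by positivity) hs.1


lemma int_deriv' (F : ℝ → ℝ → ℝ)
    (hF : ContDiffOn ℝ 1 (fun p : ℝ × ℝ => F p.1 p.2) (Set.univ ×ˢ Set.Ici 0)) (t : ℝ)
    (ht : 0 < t) (f h : ℝ → ℝ) (hf : Continuous f) (hh : ContDiff ℝ 1 h)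
    (hp : Function.Periodic h (2*π))
    (he : ∀ x, deriv (fun s => F x s) t = f x + deriv h x) :
    HasDerivAt (fun t => ∫ x in (0:ℝ)..(2*π), F x t) (∫ x in (0:ℝ)..(2*π), f x) t := by
  have h1 := int_deriv F hF t ht
  simp_rw [he] at h1
  rw [intervalIntegral.integral_add (hf.intervalIntegrable _ _)
    ((hh.continuous_deriv (by norm_num)).intervalIntegrable _ _), int_deriv_zero h hh hp,
    add_zero] at h1
  exact h1

lemma antitone_aux (f : ℝ → ℝ) (T : ℝ) (hc : ContinuousOn f (Set.Ici 0))
    (hd : ∀ t, 0 < t → t < T → ∃ d, HasDerivAt f d t ∧ d ≤ 0) :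
    ∀ t, 0 ≤ t → t ≤ T → f t ≤ f 0 := by
  have : AntitoneOn f (Set.Icc 0 T) := by
    apply antitoneOn_of_deriv_nonpos (convex_Icc 0 T) (hc.mono Set.Icc_subset_Ici_self)
    · intro t ht
      rw [interior_Icc] at ht
      obtain ⟨d, h, _⟩ := hd t ht.1 ht.2
      exact h.differentiableAt.differentiableWithinAt
    · intro t ht
      rw [interior_Icc] at ht
      obtain ⟨d, h, h'⟩ := hd t ht.1 ht.2
      rw [h.deriv]; exact h'
  intro t h0 hT
  exact this ⟨le_rfl, h0.trans hT⟩ ⟨h0, hT⟩ h0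

lemma const_aux (f : ℝ → ℝ) (hc : ContinuousOn f (Set.Ici 0))
    (hd : ∀ t, 0 < t → HasDerivAt f 0 t) (t : ℝ) (ht : 0 ≤ t) : f t = f 0 := by
  apply le_antisymm
  · exact antitone_aux f t hc (fun s hs _ => ⟨0, hd s hs, le_rfl⟩) t ht le_rfl
  · have := antitone_aux (fun s => - f s) t hc.neg
      (fun s hs _ => ⟨-0, (hd s hs).neg, by simp⟩) t ht le_rfl
    linarith

lemma bootstrap (C c w K : ℝ) (hC : 0 < C) (hc : 0 ≤ c) (hw : 0 < w) (hK : 0 ≤ K)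
    (Q E R : ℝ → ℝ)
    (hQc : ContinuousOn Q (Set.Ici 0)) (hEc : ContinuousOn E (Set.Ici 0))
    (hRc : ContinuousOn R (Set.Ici 0))
    (hQ0 : ∀ t, 0 ≤ t → 0 ≤ Q t) (hE0 : ∀ t, 0 ≤ t → 0 < E t)
    (hQ : ∀ t, 0 < t → c * R t ≤ C → ∃ d, HasDerivAt Q d t ∧ d ≤ -C * Q t)
    (hE : ∀ t, 0 < t → c * R t ≤ C → ∃ d, HasDerivAt E d t ∧ d ≤ 3 * C * √(E t) * √(Q t))
    (hR : ∀ t, 0 ≤ t → w * R t ≤ √(E t))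
    (hKE : w ^ 2 * K ^ 2 = 2 * E 0 + 18 * Q 0) (hcK : c * K < C) :
    ∀ t, 0 ≤ t → R t ≤ K ∧ Q t ≤ Real.exp (-C * t) * Q 0 := by
  have stepA : ∀ T, 0 ≤ T → (∀ t, 0 ≤ t → t < T → c * R t ≤ C) →
      R T ≤ K ∧ Q T ≤ Real.exp (-C * T) * Q 0 := by
    intro T hT hb
    have h1 : ∀ t, 0 ≤ t → t ≤ T → Q t ≤ Real.exp (-C * t) * Q 0 := by
      intro t ht0 htT
      have := antitone_aux (fun s => Real.exp (C * s) * Q s) T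
        ((by fun_prop : Continuous fun s => Real.exp (C * s)).continuousOn.mul hQc) ?_ t ht0 htT
      · simp only [mul_zero, Real.exp_zero, one_mul] at this
        have h2 := mul_le_mul_of_nonneg_left this (Real.exp_pos (-C * t)).le
        rwa [← mul_assoc, ← Real.exp_add, show -C * t + C * t = 0 by ring, Real.exp_zero,
          one_mul] at h2
      · intro s hs hsT
        obtain ⟨d, hd, hd'⟩ := hQ s hs (hb s hs.le hsT)
        have he : HasDerivAt (fun s => Real.exp (C * s)) (Real.exp (C * s) * C) s := by
          simpa using ((hasDerivAt_id s).const_mul C).exp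
        refine ⟨_, he.mul hd, ?_⟩
        nlinarith [Real.exp_pos (C * s)]
    refine ⟨?_, h1 T hT le_rfl⟩
    have h2 := antitone_aux (fun s => √(E s) + 3 * √(Q 0) * Real.exp (-(C/2) * s)) T
        (hEc.sqrt.add (by fun_prop : Continuous fun s => 3 * √(Q 0) *
          Real.exp (-(C/2) * s)).continuousOn) ?_ T hT le_rfl
    · simp only [mul_zero, Real.exp_zero, mul_one] at h2
      have h3 : 0 ≤ 3 * √(Q 0) * Real.exp (-(C/2) * T) := by positivity
      have h4 : w * R T ≤ √(E 0) + 3 * √(Q 0) := by linarith [hR T hT]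
      have h5 : (√(E 0) + 3 * √(Q 0)) ^ 2 ≤ (w * K) ^ 2 := by
        rw [mul_pow, hKE]
        nlinarith [Real.sq_sqrt (hQ0 0 le_rfl), Real.sq_sqrt (hE0 0 le_rfl).le,
          sq_nonneg (√(E 0) - 3 * √(Q 0))]
      have h6 := abs_le_of_sq_le_sq h5 (by positivity)
      have h7 : w * R T ≤ w * K := h4.trans ((le_abs_self _).trans h6)
      exact le_of_mul_le_mul_left h7 hw
    · intro s hs hsT
      obtain ⟨d, hd, hd'⟩ := hE s hs (hb s hs.le hsT)
      have he : HasDerivAt (fun s => Real.exp (-(C/2) * s)) (Real.exp (-(C/2) * s) * (-(C/2))) s := by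
        simpa using ((hasDerivAt_id s).const_mul (-(C/2))).exp
      refine ⟨_, (hd.sqrt (hE0 s hs.le).ne').add (he.const_mul (3 * √(Q 0))), ?_⟩
      have hpos : 0 < √(E s) := Real.sqrt_pos.mpr (hE0 s hs.le)
      have h8 : d / (2 * √(E s)) ≤ 3 / 2 * C * √(Q s) := by
        rw [div_le_iff₀ (by positivity)]
        nlinarith
      have h9 : √(Q s) ≤ Real.exp (-(C/2) * s) * √(Q 0) := by
        have := Real.sqrt_le_sqrt (h1 s hs.le hsT.le)
        rw [Real.sqrt_mul (Real.exp_pos _).le] at this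
        have e2 : √(Real.exp (-C * s)) = Real.exp (-(C/2) * s) := by
          rw [show -C * s = (-(C/2) * s) + (-(C/2) * s) by ring, Real.exp_add,
            Real.sqrt_mul_self (Real.exp_pos _).le]
        rwa [e2] at this
      have h10 := mul_le_mul_of_nonneg_left h9 (show 0 ≤ 3 / 2 * C by positivity)
      linarith
  have stepB : ∀ t, 0 ≤ t → c * R t ≤ C := by
    by_contra hcon
    push Not at hcon
    obtain ⟨t1, ht1, hbad⟩ := hcon
    set S : Set ℝ := {t | 0 ≤ t ∧ C < c * R t} with hS
    have hne : S.Nonempty := ⟨t1, ht1, hbad⟩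
    have hbdd : BddBelow S := ⟨0, fun t ht => ht.1⟩
    have hT0 : 0 ≤ sInf S := le_csInf hne fun t ht => ht.1
    have hA := (stepA (sInf S) hT0 (fun t ht htT => by
      by_contra h
      exact absurd (csInf_le hbdd (show t ∈ S from ⟨ht, not_le.mp h⟩)) (not_le.mpr htT))).1
    have hlt : c * R (sInf S) < C := lt_of_le_of_lt (mul_le_mul_of_nonneg_left hA hc) hcK
    have hcw : ContinuousWithinAt (fun t => c * R t) (Set.Ici 0) (sInf S) :=
      (continuousOn_const.mul hRc) _ hT0
    have hev := hcw.eventually (gt_mem_nhds hlt)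
    obtain ⟨δ, hδ, hball⟩ := Metric.mem_nhdsWithin_iff.mp hev
    have : sInf S + δ ≤ sInf S := by
      apply le_csInf hne
      intro t ht
      by_contra h
      push Not at h
      have h2 := csInf_le hbdd ht
      have h3 : c * R t < C := hball ⟨by
        rw [Metric.mem_ball, Real.dist_eq, abs_lt]; constructor <;> linarith, ht.1⟩
      exact absurd ht.2 (not_lt.mpr h3.le)
    linarith
  intro t ht
  exact stepA t ht (fun s hs _ => stepB s hs)

end helpers

/-- Proposition `local_result`: global boundedness and exponential PDE flocking for the
reduced Cucker-Smale PDE with kernel `a = C_a + θg` under the smallness assumption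
`4θ‖g‖K < C_a`. -/
theorem stmt0 (Ca θ : ℝ) (hCa : 0 < Ca) (hθ : 0 ≤ θ)
    (g : ℝ → ℝ) (hg_cont : Continuous g) (hg_per : Function.Periodic g (2*π))
    (a : ℝ → ℝ) (ha : a = fun x => Ca + θ * g x)
    (ha_even : ∀ x, a (-x) = a x) (ha_pos : ∀ x, 0 < a x)
    (vbar : ℝ) (hvbar : vbar ≠ 0)
    (ρ j : ℝ → ℝ → ℝ) (hsol : IsClassicalSol a vbar ρ j (Set.Ici 0))
    (hmass_rho : (∫ x in (0:ℝ)..(2*π), ρ x 0) = 1)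
    (hmass_j : (∫ x in (0:ℝ)..(2*π), j x 0) = vbar)
    (K : ℝ)
    (hK : K = Real.sqrt
      (2 * (vbar ^ 2 * nrm (fun x => ρ x 0) ^ 2 + nrm (fun x => j x 0) ^ 2) / vbar ^ 2
        + 18 * nrm (fun x => j x 0 - vbar * ρ x 0) ^ 2 / vbar ^ 2))
    (hsmall : 4 * θ * nrm g * K < Ca) :
    ∀ t ≥ (0:ℝ),
      nrm (fun x => ρ x t) ≤ K ∧
      nrm (fun x => j x t - vbar * ρ x t) ^ 2 ≤
        Real.exp (-Ca * t) * nrm (fun x => j x 0 - vbar * ρ x 0) ^ 2 := by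
  subst ha
  set a : ℝ → ℝ := fun x => Ca + θ * g x with ha
  have hac : Continuous a := by rw [ha]; fun_prop
  have srho : ContDiffOn ℝ 1 (fun p : ℝ × ℝ => ρ p.1 p.2) (Set.univ ×ˢ Set.Ici 0) :=
    hsol.smooth_rho.of_le (by exact_mod_cast le_top)
  have sj : ContDiffOn ℝ 1 (fun p : ℝ × ℝ => j p.1 p.2) (Set.univ ×ˢ Set.Ici 0) :=
    hsol.smooth_j.of_le (by exact_mod_cast le_top)
  -- slices in space
  have slice : ∀ u : ℝ → ℝ → ℝ,
      ContDiffOn ℝ 1 (fun p : ℝ × ℝ => u p.1 p.2) (Set.univ ×ˢ Set.Ici 0) →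
      ∀ t, 0 ≤ t → ContDiff ℝ 1 (fun x => u x t) := by
    intro u hu t ht
    exact hu.comp_contDiff (f := fun x : ℝ => (x, t)) (by fun_prop) (fun x => ⟨trivial, ht⟩)
  -- slices in time
  have tslice : ∀ u : ℝ → ℝ → ℝ,
      ContDiffOn ℝ 1 (fun p : ℝ × ℝ => u p.1 p.2) (Set.univ ×ˢ Set.Ici 0) →
      ∀ t, 0 < t → ∀ x, HasDerivAt (fun s => u x s) (derivWithin (fun s => u x s) (Set.Ici 0) t) t := by
    intro u hu t ht x
    have h1 : ContDiffOn ℝ 1 (fun s => u x s) (Set.Ici 0) :=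
      hu.comp (f := fun s : ℝ => (x, s)) (by fun_prop) (fun s hs => ⟨trivial, hs⟩)
    have h2 := (h1.differentiableOn (by norm_num)) t ht.le
    rw [derivWithin_of_mem_nhds (Ici_mem_nhds ht)]
    exact (h2.differentiableAt (Ici_mem_nhds ht)).hasDerivAt
  have cr := slice ρ srho
  have cj := slice j sj
  have dr : ∀ t, 0 < t → ∀ x, HasDerivAt (fun s => ρ x s) (- deriv (fun y => j y t) x) t := by
    intro t ht x
    have := tslice ρ srho t ht x
    rwa [hsol.pde_rho x t ht.le] at this
  have dj : ∀ t, 0 < t → ∀ x, HasDerivAt (fun s => j x s) (ρ x t * conv1 a (fun y => j y t) x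
      - j x t * conv1 a (fun y => ρ y t) x - vbar ^ 2 * deriv (fun y => ρ y t) x) t := by
    intro t ht x
    have := tslice j sj t ht x
    rwa [hsol.pde_j x t ht.le] at this
  have xr : ∀ t, 0 ≤ t → ∀ x, HasDerivAt (fun y => ρ y t) (deriv (fun y => ρ y t) x) x :=
    fun t ht x => ((cr t ht).differentiable (by norm_num) x).hasDerivAt
  have xj : ∀ t, 0 ≤ t → ∀ x, HasDerivAt (fun y => j y t) (deriv (fun y => j y t) x) x :=
    fun t ht x => ((cj t ht).differentiable (by norm_num) x).hasDerivAt
  -- conservation laws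
  have mr : ∀ t, 0 ≤ t → (∫ x in (0:ℝ)..(2*π), ρ x t) = 1 := by
    intro t ht
    rw [← hmass_rho]
    refine const_aux (fun t => ∫ x in (0:ℝ)..(2*π), ρ x t) (int_cont ρ srho.continuousOn) ?_ t ht
    intro s hs
    have := int_deriv' ρ srho s hs (fun _ => 0) (fun x => - j x s) continuous_const
      (cj s hs.le).neg (fun x => by simpa using hsol.periodic_j s hs.le x) (fun x => by
        rw [(dr s hs x).deriv, (xj s hs.le x).fun_neg.deriv]; ring)
    simpa using this
  have mj : ∀ t, 0 ≤ t → (∫ x in (0:ℝ)..(2*π), j x t) = vbar := by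
    intro t ht
    rw [← hmass_j]
    refine const_aux (fun t => ∫ x in (0:ℝ)..(2*π), j x t) (int_cont j sj.continuousOn) ?_ t ht
    intro s hs
    have c1 := (cr s hs.le).continuous
    have c2 := (cj s hs.le).continuous
    have c3 := conv1_cont a _ hac c1
    have c4 := conv1_cont a _ hac c2
    have := int_deriv' j sj s hs (fun x => ρ x s * conv1 a (fun y => j y s) x
      - j x s * conv1 a (fun y => ρ y s) x) (fun x => -vbar ^ 2 * ρ x s) (by fun_prop)
      (contDiff_const.mul (cr s hs.le))
      (fun x => by simpa using Or.inl (hsol.periodic_rho s hs.le x)) (fun x => by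
        rw [(dj s hs x).deriv, ((xr s hs.le x).const_mul (-vbar ^ 2)).deriv]; ring)
    rw [intervalIntegral.integral_sub (Continuous.intervalIntegrable (by fun_prop) _ _)
      (Continuous.intervalIntegrable (by fun_prop) _ _), conv1_symm a _ _ hac c2 c1 ha_even, sub_self] at this
    exact this
  -- the fluctuation
  set q : ℝ → ℝ → ℝ := fun x t => j x t - vbar * ρ x t with hq
  have sq : ContDiffOn ℝ 1 (fun p : ℝ × ℝ => q p.1 p.2) (Set.univ ×ˢ Set.Ici 0) :=
    sj.sub (contDiffOn_const.mul srho)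
  have cq := slice q sq
  have mq : ∀ t, 0 ≤ t → (∫ x in (0:ℝ)..(2*π), q x t) = 0 := by
    intro t ht
    rw [hq]
    simp only
    have c1 := (cr t ht).continuous
    rw [intervalIntegral.integral_sub ((cj t ht).continuous.intervalIntegrable _ _)
      (Continuous.intervalIntegrable (by fun_prop) _ _),
      intervalIntegral.integral_const_mul, mr t ht, mj t ht]
    ring
  have pq : ∀ t, 0 ≤ t → Function.Periodic (fun x => q x t) (2*π) := by
    intro t ht x
    have h1 := hsol.periodic_rho t ht x
    have h2 := hsol.periodic_j t ht x
    simp only at h1 h2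
    simp only [hq, h1, h2]
  set D : ℝ → ℝ → ℝ := fun t x => ρ x t * conv1 a (fun y => q y t) x
      - q x t * conv1 a (fun y => ρ y t) x with hD
  have hDj : ∀ t, 0 ≤ t → ∀ x, ρ x t * conv1 a (fun y => j y t) x
      - j x t * conv1 a (fun y => ρ y t) x = D t x := by
    intro t ht x
    simp only [hD, hq]
    rw [conv1_lin a _ _ vbar hac (cj t ht).continuous (cr t ht).continuous]
    ring
  have cD : ∀ t, 0 ≤ t → Continuous (D t) := by
    intro t ht
    have c1 := (cr t ht).continuous
    have c2 := (cq t ht).continuous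
    exact (c1.mul (conv1_cont a _ hac c2)).sub (c2.mul (conv1_cont a _ hac c1))
  have est := fun (t : ℝ) (ht : 0 ≤ t) => static_est Ca θ hCa hθ g (fun x => q x t)
    (fun x => ρ x t) hg_cont hg_per (cq t ht).continuous (cr t ht).continuous (mq t ht) (mr t ht)
    (D t) rfl
  have derQ : ∀ t, 0 < t → HasDerivAt (fun t => ip (fun x => q x t) (fun x => q x t))
      (2 * ∫ x in (0:ℝ)..(2*π), q x t * D t x) t := by
    intro t ht
    have c2 := (cq t ht.le).continuous
    have c3 := cD t ht.le
    have := int_deriv' (fun x t => q x t * q x t) (sq.mul sq) t ht (fun x => 2 * (q x t * D t x))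
      (fun x => vbar * (q x t * q x t)) (by fun_prop) (contDiff_const.mul
        ((cq t ht.le).mul (cq t ht.le)))
      (fun x => by
        have := pq t ht.le x
        simp only at this
        simp only [this]) (fun x => by
        have h1 := (dj t ht x).fun_sub ((dr t ht x).const_mul vbar)
        have h2 := (xj t ht.le x).fun_sub ((xr t ht.le x).const_mul vbar)
        rw [(h1.fun_mul h1).deriv, ((h2.fun_mul h2).const_mul vbar).deriv, hDj t ht.le]
        simp only [hq]
        ring)
    rw [intervalIntegral.integral_const_mul] at this
    exact this
  have derE : ∀ t, 0 < t → HasDerivAt (fun t => ∫ x in (0:ℝ)..(2*π),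
      (vbar ^ 2 * (ρ x t * ρ x t) + j x t * j x t))
      (2 * (∫ x in (0:ℝ)..(2*π), q x t * D t x)
        + 2 * vbar * ∫ x in (0:ℝ)..(2*π), ρ x t * D t x) t := by
    intro t ht
    have c1 := (cr t ht.le).continuous
    have c2 := (cq t ht.le).continuous
    have c3 := cD t ht.le
    have := int_deriv' (fun x t => vbar ^ 2 * (ρ x t * ρ x t) + j x t * j x t)
      ((contDiffOn_const.mul (srho.mul srho)).add (sj.mul sj)) t ht
      (fun x => 2 * (q x t * D t x) + 2 * vbar * (ρ x t * D t x))
      (fun x => (-2 * vbar ^ 2) * (ρ x t * j x t)) (by fun_prop) (contDiff_const.mul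
        ((cr t ht.le).mul (cj t ht.le)))
      (fun x => by
        have h1 := hsol.periodic_rho t ht.le x
        have h2 := hsol.periodic_j t ht.le x
        simp only at h1 h2
        simp only [h1, h2]) (fun x => by
        have h1 := dj t ht x
        have h2 := dr t ht x
        rw [(((h2.fun_mul h2).const_mul (vbar ^ 2)).fun_add (h1.fun_mul h1)).deriv,
          (((xr t ht.le x).fun_mul (xj t ht.le x)).const_mul (-2 * vbar ^ 2)).deriv, hDj t ht.le]
        simp only [hq]
        ring)
    rw [intervalIntegral.integral_add, intervalIntegral.integral_const_mul,
      intervalIntegral.integral_const_mul] at this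
    · exact this
    all_goals exact Continuous.intervalIntegrable (by fun_prop) _ _
  have eqE : ∀ t, 0 ≤ t → (∫ x in (0:ℝ)..(2*π), (vbar ^ 2 * (ρ x t * ρ x t) + j x t * j x t))
      = vbar ^ 2 * nrm (fun x => ρ x t) ^ 2 + nrm (fun x => j x t) ^ 2 := by
    intro t ht
    have c1 := (cr t ht).continuous
    have c2 := (cj t ht).continuous
    rw [nrm_sq, nrm_sq]
    unfold ip
    rw [intervalIntegral.integral_add, intervalIntegral.integral_const_mul]
    all_goals exact Continuous.intervalIntegrable (by fun_prop) _ _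
  have hv2 : 0 < vbar ^ 2 := by positivity
  have rpos : ∀ t, 0 ≤ t → 0 < nrm (fun x => ρ x t) := by
    intro t ht
    have := ip_cs (fun x => ρ x t) (fun _ => 1) (cr t ht).continuous continuous_const
    unfold ip at this
    simp only [mul_one, mr t ht, abs_one] at this
    by_contra h
    have h0 : nrm (fun x => ρ x t) = 0 := le_antisymm (not_lt.mp h) (nrm_nonneg _)
    rw [h0, zero_mul] at this
    linarith
  have hwR : ∀ t, 0 ≤ t → |vbar| * nrm (fun x => ρ x t) ≤
      √(∫ x in (0:ℝ)..(2*π), (vbar ^ 2 * (ρ x t * ρ x t) + j x t * j x t)) := by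
    intro t ht
    apply Real.le_sqrt_of_sq_le
    rw [eqE t ht, mul_pow, sq_abs]
    nlinarith [sq_nonneg (nrm (fun x => j x t))]
  have Kn : 0 ≤ K := by rw [hK]; exact Real.sqrt_nonneg _
  have main := bootstrap Ca (4 * θ * nrm g) |vbar| K hCa
    (by have := nrm_nonneg g; positivity) (abs_pos.mpr hvbar) Kn
    (fun t => ip (fun x => q x t) (fun x => q x t))
    (fun t => ∫ x in (0:ℝ)..(2*π), (vbar ^ 2 * (ρ x t * ρ x t) + j x t * j x t))
    (fun t => nrm (fun x => ρ x t))
    (int_cont (fun x t => q x t * q x t) (sq.mul sq).continuousOn)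
    (int_cont (fun x t => vbar ^ 2 * (ρ x t * ρ x t) + j x t * j x t)
      ((contDiffOn_const.mul (srho.mul srho)).add (sj.mul sj)).continuousOn)
    (int_cont (fun x t => ρ x t * ρ x t) (srho.mul srho).continuousOn).sqrt
    (fun t _ => ip_self_nonneg _)
    (fun t ht => by
      rw [eqE t ht]
      have := rpos t ht
      positivity)
    (fun t ht hs => ⟨_, derQ t ht, by
      have h1 := (est t ht.le).1
      beta_reduce at hs ⊢
      rw [← nrm_sq]
      nlinarith [mul_le_mul_of_nonneg_right hs (sq_nonneg (nrm fun x => q x t))]⟩)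
    (fun t ht hs => ⟨_, derE t ht, by
      obtain ⟨h1, h2⟩ := est t ht.le
      have h3 := hwR t ht.le
      beta_reduce at hs ⊢
      change _ ≤ _ * nrm (fun x => q x t)
      have Qn := nrm_nonneg (fun x => q x t)
      have Rn := nrm_nonneg (fun x => ρ x t)
      have h4 : (∫ x in (0:ℝ)..(2*π), q x t * D t x) ≤ 0 := by
        nlinarith [mul_le_mul_of_nonneg_right hs (sq_nonneg (nrm fun x => q x t)),
          mul_nonneg hCa.le (sq_nonneg (nrm fun x => q x t))]
      have h5 : |∫ x in (0:ℝ)..(2*π), ρ x t * D t x| ≤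
          3 / 2 * Ca * (nrm (fun x => ρ x t) * nrm (fun x => q x t)) := by
        nlinarith [mul_le_mul_of_nonneg_right hs (mul_nonneg Rn Qn)]
      have h6 : vbar * (∫ x in (0:ℝ)..(2*π), ρ x t * D t x) ≤
          |vbar| * (3 / 2 * Ca * (nrm (fun x => ρ x t) * nrm (fun x => q x t))) := by
        refine (le_abs_self _).trans ?_
        rw [abs_mul]
        exact mul_le_mul_of_nonneg_left h5 (abs_nonneg _)
      have h7 := mul_le_mul_of_nonneg_left h3 (mul_nonneg (mul_nonneg zero_le_three hCa.le) Qn)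
      linarith⟩)
    hwR
    (by
      have e0 := eqE 0 le_rfl
      beta_reduce
      rw [e0, ← nrm_sq, hK, Real.sq_sqrt (by positivity), sq_abs]
      field_simp
      simp only [hq])
    hsmall
  intro t ht
  have := main t ht
  simp only [← nrm_sq] at this
  exact this
end

section
/- Let C_a > 0 and let a : 𝕋 → ℝ be the constant kernel a ≡ C_a. Let v̄ ∈ ℝ and let (ρ, j) be a classical solution of the reduced Cucker–Smale PDE with kernel a and parameter v̄ on [0,∞), satisfying ∫_𝕋 ρ(x,0) dx = 1 and ∫_𝕋 j(x,0) dx = v̄. Then for all t ≥ 0: ‖j(·,t) − v̄ρ(·,t)‖² ≤ e^{−2C_a t} ‖j(·,0) − v̄ρ(·,0)‖². -/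
open Real MeasureTheory

lemma aux_slice_x {F : ℝ → ℝ → ℝ}
    (hF : ContDiffOn ℝ (⊤ : ℕ∞) (fun p : ℝ × ℝ => F p.1 p.2) (Set.univ ×ˢ Set.Ici 0))
    {t : ℝ} (ht : 0 ≤ t) : ContDiff ℝ (⊤ : ℕ∞) (fun x => F x t) := by
  have h : ContDiff ℝ (⊤ : ℕ∞) (fun x : ℝ => (x, t)) := by fun_prop
  exact hF.comp_contDiff h (fun x => by simp [ht])

lemma aux_cont {F : ℝ → ℝ → ℝ}
    (hF : ContDiffOn ℝ (⊤ : ℕ∞) (fun p : ℝ × ℝ => F p.1 p.2) (Set.univ ×ˢ Set.Ici 0)) :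
    ContinuousOn (fun t => ∫ x in (0:ℝ)..(2*π), F x t) (Set.Ici 0) := by
  have h2 : Continuous (fun p : ℝ × ℝ => F p.2 (max p.1 0)) :=
    hF.continuousOn.comp_continuous (f := fun p : ℝ × ℝ => (p.2, max p.1 0))
      (by fun_prop) (fun x => by simp)
  have h3 : Continuous (fun t => ∫ x in (0:ℝ)..(2*π), F x (max t 0)) :=
    intervalIntegral.continuous_parametric_intervalIntegral_of_continuous'
      (f := fun t x => F x (max t 0)) h2 _ _
  refine h3.continuousOn.congr (fun t ht => ?_)
  have ht' : (0:ℝ) ≤ t := ht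
  simp only [max_eq_left ht']

lemma aux_slice_t {F : ℝ → ℝ → ℝ}
    (hF : ContDiffOn ℝ (⊤ : ℕ∞) (fun p : ℝ × ℝ => F p.1 p.2) (Set.univ ×ˢ Set.Ici 0))
    (x : ℝ) {t : ℝ} (ht : 0 < t) :
    HasDerivAt (fun s => F x s) (fderiv ℝ (fun p : ℝ × ℝ => F p.1 p.2) (x, t) (0, 1)) t := by
  have hn : Set.univ ×ˢ Set.Ici (0:ℝ) ∈ nhds (x, t) :=
    prod_mem_nhds Filter.univ_mem (Ici_mem_nhds ht)
  have hd := ((hF.contDiffAt hn).differentiableAt (by simp)).hasFDerivAt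
  have hc : HasDerivAt (fun s : ℝ => (x, s)) ((0:ℝ), (1:ℝ)) t :=
    (hasDerivAt_const t x).prodMk (hasDerivAt_id t)
  exact hd.comp_hasDerivAt t hc

lemma aux_leibniz {F : ℝ → ℝ → ℝ}
    (hF : ContDiffOn ℝ (⊤ : ℕ∞) (fun p : ℝ × ℝ => F p.1 p.2) (Set.univ ×ˢ Set.Ici 0))
    {t : ℝ} (ht : 0 < t) :
    HasDerivAt (fun t => ∫ x in (0:ℝ)..(2*π), F x t)
      (∫ x in (0:ℝ)..(2*π), deriv (fun s => F x s) t) t := by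
  set D : ℝ → ℝ → ℝ := fun s x => fderiv ℝ (fun p : ℝ × ℝ => F p.1 p.2) (x, s) (0, 1) with hD
  have hDc : ContinuousOn (fun p : ℝ × ℝ => D p.2 p.1) (Set.univ ×ˢ Set.Ioi 0) := by
    have h1 := (hF.mono (Set.prod_mono_right Set.Ioi_subset_Ici_self)).continuousOn_fderiv_of_isOpen
      (isOpen_univ.prod isOpen_Ioi) (by simp)
    exact h1.clm_apply continuousOn_const
  have hK : IsCompact (Set.uIcc (0:ℝ) (2*π) ×ˢ Set.Icc (t/2) (2*t)) :=
    isCompact_uIcc.prod isCompact_Icc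
  obtain ⟨C, hC⟩ := hK.exists_bound_of_continuousOn
    (hDc.mono (Set.prod_mono (Set.subset_univ _)
      (fun s hs => lt_of_lt_of_le (by positivity : 0 < t/2) hs.1)))
  have hDt : Continuous (D t) :=
    hDc.comp_continuous (f := fun x : ℝ => (x, t)) (by fun_prop) (fun x => by simp [ht])
  have := (intervalIntegral.hasDerivAt_integral_of_dominated_loc_of_deriv_le
    (μ := volume) (a := 0) (b := 2*π) (F := fun s x => F x s) (F' := D) (x₀ := t)
    (s := Set.Icc (t/2) (2*t)) (bound := fun _ => C)
    (Icc_mem_nhds (by linarith) (by linarith))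
    (by
      filter_upwards [Ioi_mem_nhds ht] with s hs
      exact (aux_slice_x hF (le_of_lt hs)).continuous.aestronglyMeasurable)
    ((aux_slice_x hF ht.le).continuous.intervalIntegrable _ _)
    hDt.aestronglyMeasurable
    (Filter.Eventually.of_forall fun x hx s hs =>
      hC (x, s) ⟨Set.uIoc_subset_uIcc hx, hs⟩)
    (by simp)
    (Filter.Eventually.of_forall fun x hx s hs =>
      aux_slice_t hF x (lt_of_lt_of_le (by positivity : 0 < t/2) hs.1))).2
  have he : ∀ x, deriv (fun s => F x s) t = D t x := fun x => (aux_slice_t hF x ht).deriv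
  simp only [he]
  exact this

lemma aux_const {f : ℝ → ℝ} (hc : ContinuousOn f (Set.Ici 0))
    (hd : ∀ t > 0, HasDerivAt f 0 t) {t : ℝ} (ht : 0 ≤ t) : f t = f 0 := by
  have hdiff : DifferentiableOn ℝ f (interior (Set.Ici 0)) := by
    rw [interior_Ici]
    exact fun s hs => (hd s hs).differentiableAt.differentiableWithinAt
  apply le_antisymm
  · refine antitoneOn_of_deriv_nonpos (convex_Ici 0) hc hdiff ?_ (by simp) (by simpa using ht) ht
    rw [interior_Ici]
    exact fun s hs => (hd s hs).deriv.le
  · refine monotoneOn_of_deriv_nonneg (convex_Ici 0) hc hdiff ?_ (by simp) (by simpa using ht) ht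
    rw [interior_Ici]
    exact fun s hs => (hd s hs).deriv.ge

lemma aux_int_deriv {f : ℝ → ℝ} (hf : ContDiff ℝ (⊤ : ℕ∞) f)
    (hp : Function.Periodic f (2*π)) : ∫ x in (0:ℝ)..(2*π), deriv f x = 0 := by
  rw [intervalIntegral.integral_deriv_eq_sub]
  · have := hp 0
    simp only [zero_add] at this
    rw [this, sub_self]
  · exact fun x _ => hf.differentiable (by simp) x
  · exact (hf.continuous_deriv (by simp)).intervalIntegrable _ _

/-- Lemma `thm_flocking_alignment`: PDE flocking with constant interaction kernel
`a ≡ C_a`, with exponential rate `2C_a`. -/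
theorem stmt2 (Ca : ℝ) (hCa : 0 < Ca) (vbar : ℝ) (ρ j : ℝ → ℝ → ℝ)
    (hsol : IsClassicalSol (fun _ => Ca) vbar ρ j (Set.Ici 0))
    (hmass_rho : (∫ x in (0:ℝ)..(2*π), ρ x 0) = 1)
    (hmass_j : (∫ x in (0:ℝ)..(2*π), j x 0) = vbar) :
    ∀ t ≥ (0:ℝ),
      nrm (fun x => j x t - vbar * ρ x t) ^ 2 ≤
        Real.exp (-(2 * Ca) * t) * nrm (fun x => j x 0 - vbar * ρ x 0) ^ 2 := by
  have hr := hsol.smooth_rho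
  have hj := hsol.smooth_j
  have dw : ∀ (f : ℝ → ℝ) (t : ℝ), 0 < t → derivWithin f (Set.Ici 0) t = deriv f t :=
    fun f t ht => derivWithin_of_mem_nhds (Ici_mem_nhds ht)
  have hM : ∀ t ≥ (0:ℝ), (∫ x in (0:ℝ)..(2*π), ρ x t) = 1 := by
    intro t ht
    rw [← hmass_rho]
    refine aux_const (f := fun t => ∫ x in (0:ℝ)..(2*π), ρ x t) (aux_cont hr) ?_ ht
    intro s hs
    have h := aux_leibniz hr hs
    have he : ∀ x, deriv (fun s => ρ x s) s = - deriv (fun y => j y s) x := fun x => by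
      rw [← dw _ s hs]; exact hsol.pde_rho x s hs.le
    simp only [he, intervalIntegral.integral_neg] at h
    rwa [aux_int_deriv (aux_slice_x hj hs.le) (hsol.periodic_j s hs.le), neg_zero] at h
  have hpj : ∀ (x t : ℝ), 0 < t → deriv (fun s => j x s) t =
      ρ x t * (Ca * ∫ y in (0:ℝ)..(2*π), j y t) - j x t * Ca
        - vbar ^ 2 * deriv (fun y => ρ y t) x := by
    intro x t ht
    rw [← dw _ t ht, hsol.pde_j x t ht.le]
    simp only [conv1, intervalIntegral.integral_const_mul, hM t ht.le, mul_one]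
  have hJ : ∀ t ≥ (0:ℝ), (∫ x in (0:ℝ)..(2*π), j x t) = vbar := by
    intro t ht
    rw [← hmass_j]
    refine aux_const (f := fun t => ∫ x in (0:ℝ)..(2*π), j x t) (aux_cont hj) ?_ ht
    intro s hs
    have h := aux_leibniz hj hs
    have cr := (aux_slice_x hr hs.le)
    have cj := (aux_slice_x hj hs.le)
    have i1 : IntervalIntegrable (fun x => ρ x s * (Ca * ∫ y in (0:ℝ)..(2*π), j y s))
        volume 0 (2*π) := (cr.continuous.mul continuous_const).intervalIntegrable _ _
    have i2 : IntervalIntegrable (fun x => j x s * Ca) volume 0 (2*π) :=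
      (cj.continuous.mul continuous_const).intervalIntegrable _ _
    have i3 : IntervalIntegrable (fun x => vbar ^ 2 * deriv (fun y => ρ y s) x)
        volume 0 (2*π) :=
      (continuous_const.mul (cr.continuous_deriv (by simp))).intervalIntegrable _ _
    simp only [hpj _ s hs] at h
    rw [intervalIntegral.integral_sub (i1.sub i2) i3, intervalIntegral.integral_sub i1 i2,
      intervalIntegral.integral_mul_const, intervalIntegral.integral_mul_const,
      intervalIntegral.integral_const_mul, hM s hs.le,
      aux_int_deriv cr (hsol.periodic_rho s hs.le)] at h
    convert h using 1
    ring
  -- the energy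
  have hg : ContDiffOn ℝ (⊤ : ℕ∞)
      (fun p : ℝ × ℝ => (fun x t => (j x t - vbar * ρ x t) * (j x t - vbar * ρ x t)) p.1 p.2)
      (Set.univ ×ˢ Set.Ici 0) :=
    (hj.sub (contDiffOn_const.mul hr)).mul (hj.sub (contDiffOn_const.mul hr))
  set E : ℝ → ℝ := fun t =>
    ∫ x in (0:ℝ)..(2*π), (j x t - vbar * ρ x t) * (j x t - vbar * ρ x t) with hE
  have hEd : ∀ t > 0, HasDerivAt E (-(2 * Ca) * E t) t := by
    intro t ht
    have h := aux_leibniz (F := fun x t => (j x t - vbar * ρ x t) * (j x t - vbar * ρ x t)) hg ht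
    have cg := aux_slice_x (F := fun x t => (j x t - vbar * ρ x t) * (j x t - vbar * ρ x t)) hg ht.le
    have cr := (aux_slice_x hr ht.le)
    have cj := (aux_slice_x hj ht.le)
    have hper : Function.Periodic
        (fun x => (j x t - vbar * ρ x t) * (j x t - vbar * ρ x t)) (2*π) := by
      intro x
      have h1 := hsol.periodic_rho t ht.le x
      have h2 := hsol.periodic_j t ht.le x
      simp only at h1 h2 ⊢
      rw [h1, h2]
    have he : ∀ x, deriv (fun s => (j x s - vbar * ρ x s) * (j x s - vbar * ρ x s)) t =
        -(2 * Ca) * ((j x t - vbar * ρ x t) * (j x t - vbar * ρ x t)) +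
        vbar * deriv (fun y => (j y t - vbar * ρ y t) * (j y t - vbar * ρ y t)) x := by
      intro x
      have a1 := (aux_slice_t hj x ht).differentiableAt.hasDerivAt
      have a2 := (aux_slice_t hr x ht).differentiableAt.hasDerivAt
      have b1 := (cj.differentiable (by simp) x).hasDerivAt
      have b2 := (cr.differentiable (by simp) x).hasDerivAt
      have a3 := a1.sub (a2.const_mul vbar)
      have b3 := b1.sub (b2.const_mul vbar)
      have a4 := (a3.mul a3).deriv
      have b4 := (b3.mul b3).deriv
      have hr' : deriv (fun s => ρ x s) t = - deriv (fun y => j y t) x := by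
        rw [← dw _ t ht]; exact hsol.pde_rho x t ht.le
      rw [hpj x t ht, hJ t ht.le, hr'] at a4
      refine a4.trans ?_
      refine Eq.trans ?_ (congrArg (fun z => -(2 * Ca) * ((j x t - vbar * ρ x t) *
        (j x t - vbar * ρ x t)) + vbar * z) b4.symm)
      simp only [Pi.sub_apply]
      ring
    simp only [he] at h
    have i1 : IntervalIntegrable (fun x => -(2 * Ca) *
        ((j x t - vbar * ρ x t) * (j x t - vbar * ρ x t))) volume 0 (2*π) :=
      (continuous_const.mul cg.continuous).intervalIntegrable _ _
    have i2 : IntervalIntegrable (fun x => vbar *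
        deriv (fun y => (j y t - vbar * ρ y t) * (j y t - vbar * ρ y t)) x) volume 0 (2*π) :=
      (continuous_const.mul (cg.continuous_deriv (by simp))).intervalIntegrable _ _
    rw [intervalIntegral.integral_add i1 i2,
      intervalIntegral.integral_const_mul, intervalIntegral.integral_const_mul,
      aux_int_deriv cg hper, mul_zero, add_zero] at h
    exact h
  have hconst : ∀ t ≥ (0:ℝ), Real.exp (2 * Ca * t) * E t = E 0 := by
    intro t ht
    have := aux_const (f := fun t => Real.exp (2 * Ca * t) * E t)
      (ContinuousOn.mul (by fun_prop) (aux_cont (F := fun x t => (j x t - vbar * ρ x t) * (j x t - vbar * ρ x t)) hg)) ?_ ht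
    · simpa using this
    · intro s hs
      have h1 : HasDerivAt (fun t => Real.exp (2 * Ca * t))
          (Real.exp (2 * Ca * s) * (2 * Ca * 1)) s := ((hasDerivAt_id s).const_mul (2 * Ca)).exp
      refine (h1.mul (hEd s hs)).congr_deriv ?_
      ring
  have hn : ∀ t, nrm (fun x => j x t - vbar * ρ x t) ^ 2 = E t := by
    intro t
    unfold nrm ip
    rw [Real.sq_sqrt]
    exact intervalIntegral.integral_nonneg (by positivity) (fun x _ => mul_self_nonneg _)
  intro t ht
  rw [hn, hn, ← hconst t ht, ← mul_assoc, ← Real.exp_add]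
  simp
end

section
/- Let d ≥ 1, 𝕋^d := (ℝ/2πℤ)^d, C_a > 0, θ ≥ 0 and let g : 𝕋^d → ℝ be continuous; set a := C_a + θg and assume a is even and a(x) > 0 for all x ∈ 𝕋^d. Let v̄ = (v̄_1,…,v̄_d) ∈ ℝ^d, T > 0, and let b : 𝕋^d × [0,T] → [0,∞) be a nonnegative C¹ diffusion coefficient. Let ρ : 𝕋^d × [0,T] → ℝ and j = (j_1,…,j_d) : 𝕋^d × [0,T] → ℝ^d be smooth functions satisfying pointwise ∂_t ρ = −∇·j + ∇·(b∇ρ) and, for each m = 1,…,d, ∂_t j_m = ρ(a∗j_m) − j_m(a∗ρ) − v̄_m ∇·j + ∇·(b∇j_m), with ∫_{𝕋^d} ρ(x,0)dx = 1 and ∫_{𝕋^d} j_m(x,0)dx = v̄_m for each m. If 4θ‖g‖_{L²(𝕋^d)}‖ρ(·,t)‖_{L²(𝕋^d)} ≤ C_a for all t ∈ [0,T], then for all t ∈ [0,T]: Σ_{m=1}^d ‖j_m(·,t) − v̄_m ρ(·,t)‖²_{L²(𝕋^d)} ≤ e^{−C_a t} Σ_{m=1}^d ‖j_m(·,0) −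 v̄_m ρ(·,0)‖²_{L²(𝕋^d)}. -/
open Real MeasureTheory

/-- Integral over the torus `𝕋^d = (ℝ/2πℤ)^d`, with functions represented as
`2π`-periodic (in each coordinate) functions on `ℝ^d` and the integral taken over
the fundamental box `[0,2π)^d`. -/
noncomputable def tint (d : ℕ) (f : (Fin d → ℝ) → ℝ) : ℝ :=
  ∫ x in Set.univ.pi (fun _ : Fin d => Set.Ico (0:ℝ) (2*π)), f x

/-- Convolution on `𝕋^d`. -/
noncomputable def convd (d : ℕ) (f h : (Fin d → ℝ) → ℝ) (x : Fin d → ℝ) : ℝ :=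
  tint d fun y => f (x - y) * h y

/-- `L²(𝕋^d)` norm. -/
noncomputable def nrmd (d : ℕ) (f : (Fin d → ℝ) → ℝ) : ℝ :=
  Real.sqrt (tint d fun x => f x * f x)

/-- Partial derivative in the `m`-th coordinate direction. -/
noncomputable def pder (d : ℕ) (m : Fin d) (f : (Fin d → ℝ) → ℝ) (x : Fin d → ℝ) : ℝ :=
  fderiv ℝ f x (Pi.single m 1)

/-- `2π`-periodicity in every coordinate direction, i.e. `f` is a function on `𝕋^d`. -/
def PerD (d : ℕ) (f : (Fin d → ℝ) → ℝ) : Prop :=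
  ∀ (x : Fin d → ℝ) (k : Fin d), f (x + Pi.single k (2*π)) = f x


open Set

abbrev boxd (d : ℕ) : Set (Fin d → ℝ) := Set.univ.pi (fun _ : Fin d => Set.Ico (0:ℝ) (2*π))

lemma boxd_ae (d : ℕ) : boxd d =ᵐ[volume] Set.Icc (fun _ : Fin d => (0:ℝ)) (fun _ => 2*π) :=
  Measure.univ_pi_Ico_ae_eq_Icc

lemma boxd_sub (d : ℕ) : boxd d ⊆ Set.Icc (fun _ : Fin d => (0:ℝ)) (fun _ => 2*π) := by
  intro x hx
  rw [Set.mem_univ_pi] at hx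
  exact ⟨fun i => (hx i).1, fun i => (hx i).2.le⟩

lemma boxd_meas (d : ℕ) : MeasurableSet (boxd d) :=
  MeasurableSet.univ_pi fun _ => measurableSet_Ico

instance boxd_fin (d : ℕ) : IsFiniteMeasure ((volume : Measure (Fin d → ℝ)).restrict (boxd d)) := by
  constructor
  rw [Measure.restrict_apply_univ]
  exact (measure_mono (boxd_sub d)).trans_lt isCompact_Icc.measure_lt_top

lemma integ {d : ℕ} {f : (Fin d → ℝ) → ℝ} (hf : Continuous f) :
    Integrable f (volume.restrict (boxd d)) :=
  (hf.integrableOn_Icc (μ := volume)).mono_set (boxd_sub d)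

lemma tint_add {d : ℕ} {f g : (Fin d → ℝ) → ℝ} (hf : Continuous f) (hg : Continuous g) :
    tint d (fun x => f x + g x) = tint d f + tint d g :=
  integral_add (integ hf) (integ hg)

lemma tint_sub {d : ℕ} {f g : (Fin d → ℝ) → ℝ} (hf : Continuous f) (hg : Continuous g) :
    tint d (fun x => f x - g x) = tint d f - tint d g :=
  integral_sub (integ hf) (integ hg)

lemma tint_cmul {d : ℕ} (c : ℝ) (f : (Fin d → ℝ) → ℝ) :
    tint d (fun x => c * f x) = c * tint d f :=
  integral_const_mul c _

lemma tint_mono {d : ℕ} {f g : (Fin d → ℝ) → ℝ} (hf : Continuous f) (hg : Continuous g)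
    (h : ∀ x, f x ≤ g x) : tint d f ≤ tint d g :=
  integral_mono (integ hf) (integ hg) h

lemma tint_nonneg {d : ℕ} {f : (Fin d → ℝ) → ℝ} (h : ∀ x, 0 ≤ f x) : 0 ≤ tint d f :=
  integral_nonneg h

lemma nrmd_sq (d : ℕ) (f : (Fin d → ℝ) → ℝ) : nrmd d f ^ 2 = tint d (fun x => f x * f x) :=
  Real.sq_sqrt (tint_nonneg fun _ => mul_self_nonneg _)

lemma nrmd_nonneg (d : ℕ) (f : (Fin d → ℝ) → ℝ) : 0 ≤ nrmd d f := Real.sqrt_nonneg _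

lemma cs {d : ℕ} {f g : (Fin d → ℝ) → ℝ} (hf : Continuous f) (hg : Continuous g) :
    |tint d (fun x => f x * g x)| ≤ nrmd d f * nrmd d g := by
  have key : ∀ s : ℝ, 0 ≤ tint d (fun x => f x * f x) * (s * s)
      + (2 * tint d (fun x => f x * g x)) * s + tint d (fun x => g x * g x) := by
    intro s
    have h1 : tint d (fun x => (s * s) * (f x * f x) + ((2 * s) * (f x * g x) + g x * g x)) =
      (s * s) * tint d (fun x => f x * f x) + ((2 * s) * tint d (fun x => f x * g x)
        + tint d (fun x => g x * g x)) := by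
      rw [tint_add (by fun_prop) (by fun_prop), tint_add (by fun_prop) (by fun_prop),
        tint_cmul, tint_cmul]
    have h2 : 0 ≤ tint d (fun x => (s * s) * (f x * f x) + ((2 * s) * (f x * g x) + g x * g x)) :=
      tint_nonneg fun x => by nlinarith [sq_nonneg (s * f x + g x)]
    linarith
  have := discrim_le_zero key
  unfold discrim at this
  apply abs_le_of_sq_le_sq _ (mul_nonneg (nrmd_nonneg _ _) (nrmd_nonneg _ _))
  rw [mul_pow, nrmd_sq, nrmd_sq]
  linarith

lemma nrmd_abs (d : ℕ) (f : (Fin d → ℝ) → ℝ) : nrmd d (fun x => |f x|) = nrmd d f := by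
  simp [nrmd]

lemma pder_cont {d : ℕ} {f : (Fin d → ℝ) → ℝ} (hf : ContDiff ℝ 1 f) (k : Fin d) :
    Continuous (pder d k f) :=
  (hf.continuous_fderiv one_ne_zero).clm_apply continuous_const

lemma pder_contDiff {d : ℕ} {f : (Fin d → ℝ) → ℝ} (hf : ContDiff ℝ 2 f) (k : Fin d) :
    ContDiff ℝ 1 (pder d k f) :=
  (hf.fderiv_right (m := 1) (by norm_num)).clm_apply contDiff_const

lemma pder_per {d : ℕ} {f : (Fin d → ℝ) → ℝ} (hf : PerD d f) (k : Fin d) :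
    PerD d (pder d k f) := by
  intro x i
  have : (fun y => f (y + Pi.single i (2*π))) = f := funext fun y => hf y i
  unfold pder
  conv_rhs => rw [← this]
  rw [fderiv_comp_add_right]

lemma div_zero_int {d : ℕ} (V : Fin d → (Fin d → ℝ) → ℝ) (hV : ∀ k, ContDiff ℝ 1 (V k))
    (hp : ∀ k, PerD d (V k)) : tint d (fun x => ∑ k, pder d k (V k) x) = 0 := by
  cases d with
  | zero => simp [tint]
  | succ n =>
    have hc : Continuous (fun x => ∑ k, pder (n+1) k (V k) x) :=
      continuous_finsetSum _ fun k _ => pder_cont (hV k) k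
    have := integral_divergence_of_hasFDerivAt_off_countable' (fun _ : Fin (n+1) => (0:ℝ))
      (fun _ => 2*π) (fun _ => by positivity) V (fun k x => fderiv ℝ (V k) x) ∅ Set.countable_empty
      (fun i => (hV i).continuous.continuousOn)
      (fun x _ i => ((hV i).differentiable one_ne_zero x).hasFDerivAt) hc.integrableOn_Icc
    unfold tint
    rw [setIntegral_congr_set (boxd_ae (n+1))]
    refine this.trans ?_
    refine Finset.sum_eq_zero fun i _ => ?_
    rw [sub_eq_zero]
    congr 1
    funext x
    rw [← hp i (i.insertNth 0 x) i]
    congr 1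
    funext l
    refine Fin.succAboveCases i ?_ (fun l => ?_) l
    · simp
    · simp

lemma bas_fund (d : ℕ) : ∃ L : Submodule ℤ (Fin d → ℝ), Countable L ∧
    IsAddFundamentalDomain L (boxd d) volume ∧
    ∀ f : (Fin d → ℝ) → ℝ, PerD d f → ∀ (l : L) (x), f (l +ᵥ x) = f x := by
  have h2 : ∀ i : Fin d, IsUnit (2*π) := fun _ => (by positivity : (2*π) ≠ 0).isUnit
  let B := (Pi.basisFun ℝ (Fin d)).isUnitSMul h2
  have hB : ∀ i, B i = Pi.single i (2*π) := by
    intro i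
    simp only [B, Module.Basis.isUnitSMul_apply, Pi.basisFun_apply]
    ext l
    simp [Pi.single_apply]
  have hbox : ZSpan.fundamentalDomain B = boxd d := by
    ext x
    rw [ZSpan.mem_fundamentalDomain, Set.mem_univ_pi]
    refine forall_congr' fun i => ?_
    have : x i = B.repr x i * (2*π) := by
      conv_lhs => rw [← B.sum_repr x]
      simp [hB, Finset.sum_apply, Pi.single_apply]
    rw [this]
    simp only [Set.mem_Ico]
    have hp : 0 < 2*π := by positivity
    constructor
    · rintro ⟨h1, h2⟩
      exact ⟨by positivity, by nlinarith⟩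
    · rintro ⟨h1, h2⟩
      exact ⟨by by_contra h; push Not at h; nlinarith, by by_contra h; push Not at h; nlinarith⟩
  refine ⟨Submodule.span ℤ (Set.range B), inferInstance, ?_, ?_⟩
  · rw [← hbox]; exact ZSpan.isAddFundamentalDomain B volume
  · rintro f hf ⟨l, hl⟩
    change ∀ x, f (l + x) = f x
    induction hl using Submodule.span_induction with
    | mem y hy =>
      obtain ⟨i, rfl⟩ := hy
      intro x
      rw [hB, add_comm, hf]
    | zero => simp
    | add y z _ _ hy hz => intro x; rw [add_assoc, hy, hz]
    | smul c y _ hy =>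
      induction c using Int.induction_on with
      | zero => simp
      | succ c ih => intro x; rw [add_smul, one_smul, add_assoc, ih, hy]
      | pred c ih =>
        intro x
        rw [sub_smul, one_smul, sub_add_eq_add_sub, add_sub_assoc, ih, ← hy]; congr 1; abel

lemma tint_trans {d : ℕ} {f : (Fin d → ℝ) → ℝ} (hp : PerD d f) (c : Fin d → ℝ) :
    tint d (fun y => f (c - y)) = tint d f := by
  obtain ⟨L, hL, hfd, hper⟩ := bas_fund d
  have := hL
  have : VAddInvariantMeasure L (Fin d → ℝ) volume :=
    ⟨fun l s _ => measure_preimage_add volume (l : Fin d → ℝ) s⟩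
  have hmp : MeasurePreserving (fun y : Fin d → ℝ => c - y) volume volume :=
    Measure.measurePreserving_sub_left volume c
  have h2 : IsAddFundamentalDomain L ((fun y : Fin d → ℝ => c - y) '' boxd d) volume := by
    refine hfd.image_of_equiv (Equiv.subLeft c) ?_ (Equiv.neg L) ?_
    · have hsy : ⇑(Equiv.subLeft c).symm = fun y : Fin d → ℝ => c - y := by
        funext y
        simp [sub_eq_neg_add]
      rw [hsy]
      exact hmp.quasiMeasurePreserving
    · intro l x
      change c - (((-l : L) : Fin d → ℝ) + x) = (l : Fin d → ℝ) + (c - x)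
      push_cast
      abel
  have := hmp.setIntegral_image_emb (Homeomorph.subLeft c).measurableEmbedding f (boxd d)
  unfold tint
  rw [← this]
  exact h2.setIntegral_eq hfd (hper f hp)

lemma conv_bound {d : ℕ} {g u : (Fin d → ℝ) → ℝ} (hg : Continuous g) (hp : PerD d g)
    (hu : Continuous u) (x : Fin d → ℝ) : |convd d g u x| ≤ nrmd d g * nrmd d u := by
  have h := cs (f := fun y => g (x - y)) (g := u) (by fun_prop) hu
  have h2 : nrmd d (fun y => g (x - y)) = nrmd d g := by
    unfold nrmd
    congr 1
    exact tint_trans (f := fun y => g y * g y) (fun y k => by simp only [hp y k]) x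
  rw [h2] at h
  exact h

lemma conv_cont {d : ℕ} {g u : (Fin d → ℝ) → ℝ} (hg : Continuous g)
    (hu : Continuous u) : Continuous (convd d g u) := by
  have : convd d g u = fun x => ∫ y in Set.Icc (fun _ : Fin d => (0:ℝ)) (fun _ => 2*π),
      g (x - y) * u y := by
    funext x
    exact setIntegral_congr_set (boxd_ae d)
  rw [this]
  exact continuous_parametric_integral_of_continuous (by fun_prop) isCompact_Icc

lemma conv_symm {d : ℕ} {a u r : (Fin d → ℝ) → ℝ} (ha : Continuous a) (hev : ∀ x, a (-x) = a x)
    (hu : Continuous u) (hr : Continuous r) :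
    tint d (fun x => r x * convd d a u x) = tint d (fun x => u x * convd d a r x) := by
  have hint : Integrable (Function.uncurry fun x y => r x * (a (x - y) * u y))
      ((volume.restrict (boxd d)).prod (volume.restrict (boxd d))) := by
    rw [Measure.prod_restrict]
    have hc : Continuous (Function.uncurry fun x y : Fin d → ℝ => r x * (a (x - y) * u y)) := by
      unfold Function.uncurry; fun_prop
    exact (hc.continuousOn.integrableOn_compact (isCompact_Icc.prod isCompact_Icc)).mono_set
      (Set.prod_mono (boxd_sub d) (boxd_sub d))
  have h1 : tint d (fun x => r x * convd d a u x) =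
      ∫ x in boxd d, ∫ y in boxd d, r x * (a (x - y) * u y) := by
    unfold tint convd tint
    simp only [integral_const_mul]
  rw [h1, integral_integral_swap hint]
  unfold tint convd tint
  congr 1
  funext y
  beta_reduce
  rw [← integral_const_mul]
  congr 1
  funext x
  rw [← hev (x - y), neg_sub]
  ring

lemma conv_affine {d : ℕ} {Ca θ : ℝ} {g u : (Fin d → ℝ) → ℝ} (hg : Continuous g)
    (hu : Continuous u) (x : Fin d → ℝ) :
    convd d (fun x => Ca + θ * g x) u x = Ca * tint d u + θ * convd d g u x := by
  unfold convd
  rw [← tint_cmul, ← tint_cmul, ← tint_add (by fun_prop) (by fun_prop)]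
  congr 1
  funext y
  ring

lemma pder_mul {d : ℕ} {f h : (Fin d → ℝ) → ℝ} (hf : ContDiff ℝ 1 f) (hh : ContDiff ℝ 1 h)
    (k : Fin d) (x : Fin d → ℝ) :
    pder d k (fun y => f y * h y) x = f x * pder d k h x + h x * pder d k f x := by
  unfold pder
  rw [fderiv_fun_mul (hf.differentiable one_ne_zero x) (hh.differentiable one_ne_zero x)]
  simp

lemma pder_sub_cmul {d : ℕ} {f h : (Fin d → ℝ) → ℝ} (hf : ContDiff ℝ 1 f) (hh : ContDiff ℝ 1 h)
    (c : ℝ) (k : Fin d) (x : Fin d → ℝ) :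
    pder d k (fun y => f y - c * h y) x = pder d k f x - c * pder d k h x := by
  unfold pder
  rw [fderiv_fun_sub (hf.differentiable one_ne_zero x)
    ((hh.differentiable one_ne_zero x).const_mul c), fderiv_const_mul
    (hh.differentiable one_ne_zero x)]
  simp

/-- The diffusion term has zero mean. -/
lemma diff_mean {d : ℕ} {b u : (Fin d → ℝ) → ℝ} (hb : ContDiff ℝ 1 b) (hbp : PerD d b)
    (hu : ContDiff ℝ 2 u) (hup : PerD d u) :
    tint d (fun x => ∑ k, pder d k (fun y => b y * pder d k u y) x) = 0 := by
  refine div_zero_int (fun k y => b y * pder d k u y) (fun k => hb.mul (pder_contDiff hu k)) ?_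
  intro k x i
  simp only [hbp x i, pder_per hup k x i]

/-- The diffusion term is dissipative. -/
lemma diff_diss {d : ℕ} {b u : (Fin d → ℝ) → ℝ} (hb : ContDiff ℝ 1 b) (hbp : PerD d b)
    (hb0 : ∀ x, 0 ≤ b x) (hu : ContDiff ℝ 2 u) (hup : PerD d u) :
    tint d (fun x => u x * ∑ k, pder d k (fun y => b y * pder d k u y) x) ≤ 0 := by
  have hu1 : ContDiff ℝ 1 u := hu.of_le (by norm_num)
  have hV : ∀ k, ContDiff ℝ 1 (fun y => b y * pder d k u y) :=
    fun k => hb.mul (pder_contDiff hu k)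
  have h0 := div_zero_int (fun k y => u y * (b y * pder d k u y)) (fun k => hu1.mul (hV k))
    (fun k x i => by simp only [hbp x i, pder_per hup k x i, hup x i])
  have hc : Continuous (fun x => ∑ k, pder d k (fun y => u y * (b y * pder d k u y)) x) :=
    continuous_finsetSum _ fun k _ => pder_cont (hu1.mul (hV k)) k
  have hc2 : Continuous (fun x => ∑ k, pder d k (fun y => b y * pder d k u y) x) :=
    continuous_finsetSum _ fun k _ => pder_cont (hV k) k
  rw [← h0]
  refine tint_mono (hu1.continuous.mul hc2) hc fun x => ?_
  rw [Finset.mul_sum]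
  refine Finset.sum_le_sum fun k _ => ?_
  rw [pder_mul hu1 (hV k)]
  nlinarith [mul_nonneg (hb0 x) (mul_self_nonneg (pder d k u x))]

/-- The mean of the right-hand side vanishes. -/
lemma mean_rhs {d : ℕ} {a b u r : (Fin d → ℝ) → ℝ} (ha : Continuous a)
    (hev : ∀ x, a (-x) = a x) (hb : ContDiff ℝ 1 b) (hbp : PerD d b)
    (hu : ContDiff ℝ 2 u) (hup : PerD d u) (hr : Continuous r) :
    tint d (fun x => (r x * convd d a u x - u x * convd d a r x)
      + ∑ k, pder d k (fun y => b y * pder d k u y) x) = 0 := by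
  have h1 := conv_cont ha hu.continuous
  have h2 := conv_cont ha hr
  have h3 := hu.continuous
  rw [tint_add (by fun_prop) (continuous_finsetSum _ fun k _ => pder_cont
    (hb.mul (pder_contDiff hu k)) k), tint_sub (by fun_prop) (by fun_prop),
    conv_symm ha hev h3 hr, diff_mean hb hbp hu hup]
  simp

/-- The energy inequality at a fixed time. -/
lemma energy_ineq {d : ℕ} {Ca θ : ℝ} (hθ : 0 ≤ θ) {g b u r : (Fin d → ℝ) → ℝ}
    (hg : Continuous g) (hgp : PerD d g) (hb : ContDiff ℝ 1 b) (hbp : PerD d b)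
    (hb0 : ∀ x, 0 ≤ b x) (hu : ContDiff ℝ 2 u) (hup : PerD d u) (hr : Continuous r)
    (hu0 : tint d u = 0) (hr1 : tint d r = 1) (hs : 4 * θ * nrmd d g * nrmd d r ≤ Ca) :
    tint d (fun x => 2 * (u x * ((r x * convd d (fun x => Ca + θ * g x) u x
      - u x * convd d (fun x => Ca + θ * g x) r x)
      + ∑ k, pder d k (fun y => b y * pder d k u y) x))) ≤ -Ca * tint d (fun x => u x * u x) := by
  have h3 := hu.continuous
  have hcu := conv_cont hg h3
  have hcr := conv_cont hg hr
  have hD : Continuous (fun x => ∑ k, pder d k (fun y => b y * pder d k u y) x) :=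
    continuous_finsetSum _ fun k _ => pder_cont (hb.mul (pder_contDiff hu k)) k
  set G := nrmd d g
  set R := nrmd d r
  set U := nrmd d u with hU
  have hG : 0 ≤ G := nrmd_nonneg _ _
  have hR : 0 ≤ R := nrmd_nonneg _ _
  have hU0 : 0 ≤ U := nrmd_nonneg _ _
  have hUU : tint d (fun x => u x * u x) = U ^ 2 := (nrmd_sq d u).symm
  have hur : tint d (fun x => |u x| * |r x|) ≤ U * R := by
    have := cs (f := fun x => |u x|) (g := fun x => |r x|) (by fun_prop) (by fun_prop)
    rw [nrmd_abs, nrmd_abs] at this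
    exact (le_abs_self _).trans this
  have hbd : tint d (fun x => u x * ((r x * convd d (fun x => Ca + θ * g x) u x
      - u x * convd d (fun x => Ca + θ * g x) r x)
      + ∑ k, pder d k (fun y => b y * pder d k u y) x)) ≤
      tint d (fun x => (θ * G * U) * (|u x| * |r x|) + ((θ * G * R - Ca) * (u x * u x)
        + u x * ∑ k, pder d k (fun y => b y * pder d k u y) x)) := by
    simp only [conv_affine hg h3, conv_affine hg hr, hu0, hr1]
    refine tint_mono (by fun_prop) (by fun_prop) fun x => ?_
    have e1 := conv_bound hg hgp h3 x
    have e2 := conv_bound hg hgp hr x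
    have k1 : u x * r x * convd d g u x ≤ |u x| * |r x| * (G * U) := by
      refine (le_abs_self _).trans ?_
      rw [abs_mul, abs_mul]
      gcongr
    have k2 : - (u x * u x * convd d g r x) ≤ u x * u x * (G * R) := by
      rw [← mul_neg]
      exact mul_le_mul_of_nonneg_left ((neg_le_abs _).trans e2) (mul_self_nonneg _)
    have k1' := mul_le_mul_of_nonneg_left k1 hθ
    have k2' := mul_le_mul_of_nonneg_left k2 hθ
    linarith
  rw [tint_cmul]
  rw [tint_add (by fun_prop) (by fun_prop), tint_add (by fun_prop) (by fun_prop), tint_cmul,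
    tint_cmul, hUU] at hbd
  rw [hUU]
  have hd := diff_diss hb hbp hb0 hu hup
  have hm := mul_le_mul_of_nonneg_left hur (by positivity : 0 ≤ θ * G * U)
  have hs' := mul_le_mul_of_nonneg_right hs (sq_nonneg U)
  linarith

lemma slice_contDiff {d : ℕ} {T : ℝ} {n : WithTop ℕ∞} {F : (Fin d → ℝ) → ℝ → ℝ}
    (hF : ContDiffOn ℝ n (fun p : (Fin d → ℝ) × ℝ => F p.1 p.2) (Set.univ ×ˢ Set.Icc (0:ℝ) T))
    {t : ℝ} (ht : t ∈ Set.Icc 0 T) : ContDiff ℝ n (fun x => F x t) := by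
  rw [← contDiffOn_univ]
  exact hF.comp (f := fun x : Fin d → ℝ => (x, t)) (by fun_prop) (fun x _ => ⟨trivial, ht⟩)

lemma tint_contOn {d : ℕ} {T : ℝ} {F : (Fin d → ℝ) → ℝ → ℝ}
    (hF : ContinuousOn (fun p : (Fin d → ℝ) × ℝ => F p.1 p.2) (Set.univ ×ˢ Set.Icc (0:ℝ) T)) :
    ContinuousOn (fun t => tint d (fun x => F x t)) (Set.Icc 0 T) := by
  obtain ⟨C, hC⟩ := ((isCompact_Icc (a := fun _ : Fin d => (0:ℝ)) (b := fun _ => 2*π)).prod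
    (isCompact_Icc (a := (0:ℝ)) (b := T))).exists_bound_of_continuousOn
    (hF.mono (Set.prod_mono (Set.subset_univ _) subset_rfl))
  have hsl : ∀ t ∈ Set.Icc 0 T, Continuous (fun x => F x t) := fun t ht => by
    rw [← continuousOn_univ]
    exact hF.comp (f := fun x : Fin d → ℝ => (x, t)) (by fun_prop) (fun x _ => ⟨trivial, ht⟩)
  refine continuousOn_of_dominated (bound := fun _ => C) (fun t ht => (integ (hsl t ht)).1) ?_
    (integrable_const _) ?_
  · intro t ht
    filter_upwards [ae_restrict_mem (boxd_meas d)] with x hx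
    exact hC (x, t) ⟨boxd_sub d hx, ht⟩
  · refine Filter.Eventually.of_forall fun x => ?_
    exact hF.comp (f := fun t : ℝ => (x, t)) (by fun_prop) (fun t ht => ⟨trivial, ht⟩)

lemma tint_hasDeriv {d : ℕ} {T : ℝ} {F : (Fin d → ℝ) → ℝ → ℝ}
    (hF : ContDiffOn ℝ 1 (fun p : (Fin d → ℝ) × ℝ => F p.1 p.2) (Set.univ ×ˢ Set.Icc (0:ℝ) T))
    {t : ℝ} (ht : t ∈ Set.Ioo 0 T) :
    HasDerivAt (fun t => tint d (fun x => F x t))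
      (tint d (fun x => derivWithin (fun s => F x s) (Set.Icc 0 T) t)) t := by
  have hO : IsOpen ((Set.univ : Set (Fin d → ℝ)) ×ˢ Set.Ioo (0:ℝ) T) := isOpen_univ.prod isOpen_Ioo
  have hF' := hF.mono (Set.prod_mono (subset_refl (Set.univ : Set (Fin d → ℝ)))
    (Set.Ioo_subset_Icc_self (a := (0:ℝ)) (b := T)))
  have hcf := hF'.continuousOn_fderiv_of_isOpen hO le_rfl
  have hder : ∀ x, ∀ s ∈ Set.Ioo 0 T, HasDerivAt (fun s => F x s)
      (fderiv ℝ (fun p : (Fin d → ℝ) × ℝ => F p.1 p.2) (x, s) (0, 1)) s := by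
    intro x s hs
    have h1 : DifferentiableAt ℝ (fun p : (Fin d → ℝ) × ℝ => F p.1 p.2) (x, s) :=
      (hF'.differentiableOn one_ne_zero).differentiableAt (hO.mem_nhds ⟨trivial, hs⟩)
    have h2 : HasDerivAt (fun s : ℝ => (x, s)) ((0 : Fin d → ℝ), (1:ℝ)) s :=
      (hasDerivAt_const s x).prodMk (hasDerivAt_id s)
    exact h1.hasFDerivAt.comp_hasDerivAt s h2
  obtain ⟨ε, hε, hεs⟩ := Metric.nhds_basis_closedBall.mem_iff.1 (Ioo_mem_nhds ht.1 ht.2)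
  have hcf2 : ContinuousOn (fun p => fderiv ℝ (fun p : (Fin d → ℝ) × ℝ => F p.1 p.2) p (0, 1))
      ((Set.univ : Set (Fin d → ℝ)) ×ˢ Set.Ioo (0:ℝ) T) := hcf.clm_apply continuousOn_const
  obtain ⟨C, hC⟩ := ((isCompact_Icc (a := fun _ : Fin d => (0:ℝ)) (b := fun _ => 2*π)).prod
    (isCompact_closedBall t ε)).exists_bound_of_continuousOn
    (hcf2.mono (Set.prod_mono (Set.subset_univ _) hεs))
  have heq : (fun x => derivWithin (fun s => F x s) (Set.Icc 0 T) t) =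
      fun x => fderiv ℝ (fun p : (Fin d → ℝ) × ℝ => F p.1 p.2) (x, t) (0, 1) := by
    funext x
    rw [derivWithin_of_mem_nhds (Icc_mem_nhds ht.1 ht.2), (hder x t ht).deriv]
  rw [heq]
  have hsl : ∀ s ∈ Set.Ioo 0 T, Continuous (fun x => F x s) := fun s hs =>
    (slice_contDiff hF ⟨hs.1.le, hs.2.le⟩).continuous
  have hc3 : Continuous fun x =>
      fderiv ℝ (fun p : (Fin d → ℝ) × ℝ => F p.1 p.2) (x, t) (0, 1) := by
    rw [← continuousOn_univ]
    exact hcf2.comp (f := fun x : Fin d → ℝ => (x, t)) (by fun_prop) (fun x _ => ⟨trivial, ht⟩)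
  refine (hasDerivAt_integral_of_dominated_loc_of_deriv_le (F := fun s x => F x s)
    (F' := fun s x => fderiv ℝ (fun p : (Fin d → ℝ) × ℝ => F p.1 p.2) (x, s) (0, 1))
    (bound := fun _ => C) (Metric.closedBall_mem_nhds t hε) ?_ (integ (hsl t ht))
    (integ hc3).1 ?_ (integrable_const _) ?_).2
  · filter_upwards [Ioo_mem_nhds ht.1 ht.2] with s hs
    exact (integ (hsl s hs)).1
  · filter_upwards [ae_restrict_mem (boxd_meas d)] with x hx s hs
    exact hC (x, s) ⟨boxd_sub d hx, hs⟩
  · exact Filter.Eventually.of_forall fun x s hs => hder x s (hεs hs)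

lemma const_of_deriv {T : ℝ} {f : ℝ → ℝ} (hc : ContinuousOn f (Set.Icc 0 T))
    (hd : ∀ t ∈ Set.Ioo 0 T, HasDerivAt f 0 t) {t : ℝ} (ht : t ∈ Set.Icc 0 T) : f t = f 0 := by
  have h0 : (0:ℝ) ∈ Set.Icc 0 T := ⟨le_rfl, ht.1.trans ht.2⟩
  have hdiff : DifferentiableOn ℝ f (interior (Set.Icc 0 T)) := by
    rw [interior_Icc]
    exact fun s hs => (hd s hs).differentiableAt.differentiableWithinAt
  refine le_antisymm ?_ ?_
  · refine antitoneOn_of_deriv_nonpos (convex_Icc 0 T) hc hdiff ?_ h0 ht ht.1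
    intro s hs
    rw [interior_Icc] at hs
    rw [(hd s hs).deriv]
  · refine monotoneOn_of_deriv_nonneg (convex_Icc 0 T) hc hdiff ?_ h0 ht ht.1
    intro s hs
    rw [interior_Icc] at hs
    rw [(hd s hs).deriv]

lemma gronwall_exp {T C : ℝ} {f f' : ℝ → ℝ} (hc : ContinuousOn f (Set.Icc 0 T))
    (hd : ∀ t ∈ Set.Ioo 0 T, HasDerivAt f (f' t) t) (hle : ∀ t ∈ Set.Ioo 0 T, f' t ≤ -C * f t)
    {t : ℝ} (ht : t ∈ Set.Icc 0 T) : f t ≤ Real.exp (-C * t) * f 0 := by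
  have h0 : (0:ℝ) ∈ Set.Icc 0 T := ⟨le_rfl, ht.1.trans ht.2⟩
  have hder : ∀ s ∈ Set.Ioo 0 T, HasDerivAt (fun s => Real.exp (C * s) * f s)
      (Real.exp (C * s) * C * f s + Real.exp (C * s) * f' s) s := by
    intro s hs
    have : HasDerivAt (fun s => C * s) C s := by simpa using (hasDerivAt_id s).const_mul C
    exact this.exp.mul (hd s hs)
  have := antitoneOn_of_deriv_nonpos (convex_Icc 0 T)
    (f := fun s => Real.exp (C * s) * f s) ((by fun_prop : Continuous fun s =>
      Real.exp (C * s)).continuousOn.mul hc) (by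
        rw [interior_Icc]
        exact fun s hs => (hder s hs).differentiableAt.differentiableWithinAt) (by
        intro s hs
        rw [interior_Icc] at hs
        rw [(hder s hs).deriv]
        have := mul_le_mul_of_nonneg_left (hle s hs) (Real.exp_pos (C * s)).le
        linarith) h0 ht ht.1
  simp only [mul_zero, Real.exp_zero, one_mul] at this
  rw [neg_mul, Real.exp_neg, ← div_eq_inv_mul, le_div_iff₀ (Real.exp_pos _)]
  linarith

/-- Lemma `flocking_property_multi_d` / `well_posedness_reg`: flocking estimate for the
`d`-dimensional reduced Cucker-Smale PDE with a nonnegative diffusive regularisation,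
conditional on the smallness `4θ‖g‖‖ρ(·,t)‖ ≤ C_a`. -/
theorem stmt7 (Ca θ : ℝ) (hCa : 0 < Ca) (hθ : 0 ≤ θ)
    (d : ℕ) (hd : 1 ≤ d)
    (a : (Fin d → ℝ) → ℝ)
    (vbar : Fin d → ℝ) (T : ℝ) (hT : 0 < T)
    (b : (Fin d → ℝ) → ℝ → ℝ)
    (hb_per : ∀ t ∈ Set.Icc (0:ℝ) T, PerD d (fun x => b x t))
    (hb_C1 : ContDiffOn ℝ 1 (fun p : (Fin d → ℝ) × ℝ => b p.1 p.2)
      (Set.univ ×ˢ Set.Icc (0:ℝ) T))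
    (hb_nonneg : ∀ (x : Fin d → ℝ), ∀ t ∈ Set.Icc (0:ℝ) T, 0 ≤ b x t)
    (ρ : (Fin d → ℝ) → ℝ → ℝ) (j : Fin d → (Fin d → ℝ) → ℝ → ℝ)
    (hρ_per : ∀ t ∈ Set.Icc (0:ℝ) T, PerD d (fun x => ρ x t))
    (hj_per : ∀ (m : Fin d), ∀ t ∈ Set.Icc (0:ℝ) T, PerD d (fun x => j m x t))
    (hρ_smooth : ContDiffOn ℝ (⊤ : ℕ∞) (fun p : (Fin d → ℝ) × ℝ => ρ p.1 p.2)
      (Set.univ ×ˢ Set.Icc (0:ℝ) T))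
    (hj_smooth : ∀ m : Fin d, ContDiffOn ℝ (⊤ : ℕ∞) (fun p : (Fin d → ℝ) × ℝ => j m p.1 p.2)
      (Set.univ ×ˢ Set.Icc (0:ℝ) T))
    (hpde_rho : ∀ (x : Fin d → ℝ), ∀ t ∈ Set.Icc (0:ℝ) T,
      derivWithin (fun s => ρ x s) (Set.Icc 0 T) t =
        -(∑ m : Fin d, pder d m (fun y => j m y t) x)
          + ∑ m : Fin d, pder d m (fun y => b y t * pder d m (fun z => ρ z t) y) x)
    (hpde_j : ∀ (m : Fin d) (x : Fin d → ℝ), ∀ t ∈ Set.Icc (0:ℝ) T,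
      derivWithin (fun s => j m x s) (Set.Icc 0 T) t =
        ρ x t * convd d a (fun y => j m y t) x - j m x t * convd d a (fun y => ρ y t) x
          - vbar m * (∑ k : Fin d, pder d k (fun y => j k y t) x)
          + ∑ k : Fin d, pder d k (fun y => b y t * pder d k (fun z => j m z t) y) x)
    (g : (Fin d → ℝ) → ℝ) (hg_cont : Continuous g) (hg_per : PerD d g)
    (ha : a = fun x => Ca + θ * g x)
    (ha_even : ∀ x, a (-x) = a x) (ha_pos : ∀ x, 0 < a x)
    (hmass_rho : tint d (fun x => ρ x 0) = 1)
    (hmass_j : ∀ m : Fin d, tint d (fun x => j m x 0) = vbar m)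
    (hsmall : ∀ t ∈ Set.Icc (0:ℝ) T, 4 * θ * nrmd d g * nrmd d (fun x => ρ x t) ≤ Ca) :
    ∀ t ∈ Set.Icc (0:ℝ) T,
      (∑ m : Fin d, nrmd d (fun x => j m x t - vbar m * ρ x t) ^ 2) ≤
        Real.exp (-Ca * t) * ∑ m : Fin d, nrmd d (fun x => j m x 0 - vbar m * ρ x 0) ^ 2 := by
  have hac : Continuous a := by rw [ha]; fun_prop
  have hsl : ∀ m, ∀ t ∈ Set.Icc (0:ℝ) T, ContDiff ℝ 2 (fun x => j m x t) := fun m t ht =>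
    (slice_contDiff (hj_smooth m) ht).of_le (WithTop.coe_le_coe.2 (le_top : (2 : ℕ∞) ≤ ⊤))
  have hslr : ∀ t ∈ Set.Icc (0:ℝ) T, ContDiff ℝ 2 (fun x => ρ x t) := fun t ht =>
    (slice_contDiff hρ_smooth ht).of_le (WithTop.coe_le_coe.2 (le_top : (2 : ℕ∞) ≤ ⊤))
  have hslb : ∀ t ∈ Set.Icc (0:ℝ) T, ContDiff ℝ 1 (fun x => b x t) := fun t ht =>
    slice_contDiff hb_C1 ht
  have h12 : (1 : WithTop ℕ∞) ≤ 2 := by norm_num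
  have hρ1 : ContDiffOn ℝ 1 (fun p : (Fin d → ℝ) × ℝ => ρ p.1 p.2)
      (Set.univ ×ˢ Set.Icc (0:ℝ) T) := hρ_smooth.of_le (by exact_mod_cast le_top)
  have hj1 : ∀ m, ContDiffOn ℝ 1 (fun p : (Fin d → ℝ) × ℝ => j m p.1 p.2)
      (Set.univ ×ˢ Set.Icc (0:ℝ) T) := fun m => (hj_smooth m).of_le (by exact_mod_cast le_top)
  have hu1 : ∀ m, ContDiffOn ℝ 1 (fun p : (Fin d → ℝ) × ℝ => j m p.1 p.2 - vbar m * ρ p.1 p.2)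
      (Set.univ ×ˢ Set.Icc (0:ℝ) T) := fun m => (hj1 m).sub (contDiffOn_const.mul hρ1)
  have huu1 : ∀ m, ContDiffOn ℝ 1 (fun p : (Fin d → ℝ) × ℝ =>
      (j m p.1 p.2 - vbar m * ρ p.1 p.2) * (j m p.1 p.2 - vbar m * ρ p.1 p.2))
      (Set.univ ×ˢ Set.Icc (0:ℝ) T) := fun m => (hu1 m).mul (hu1 m)
  have hsu : ∀ m, ∀ t ∈ Set.Icc (0:ℝ) T, ContDiff ℝ 2 (fun x => j m x t - vbar m * ρ x t) :=
    fun m t ht => (hsl m t ht).sub (contDiff_const.mul (hslr t ht))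
  have hup : ∀ m, ∀ t ∈ Set.Icc (0:ℝ) T, PerD d (fun x => j m x t - vbar m * ρ x t) :=
    fun m t ht x k => by
      have h1 := hj_per m t ht x k
      have h2 := hρ_per t ht x k
      simp only at h1 h2 ⊢
      rw [h1, h2]
  have htime : ∀ {F : (Fin d → ℝ) → ℝ → ℝ}, ContDiffOn ℝ 1 (fun p : (Fin d → ℝ) × ℝ => F p.1 p.2)
      (Set.univ ×ˢ Set.Icc (0:ℝ) T) → ∀ x, ∀ t ∈ Set.Icc (0:ℝ) T,
      DifferentiableWithinAt ℝ (fun s => F x s) (Set.Icc 0 T) t := by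
    intro F hF x t ht
    have : ContDiffOn ℝ 1 (fun s => F x s) (Set.Icc 0 T) :=
      hF.comp (f := fun s : ℝ => (x, s)) (by fun_prop) (fun t ht => ⟨trivial, ht⟩)
    exact this.differentiableOn one_ne_zero t ht
  -- the equation satisfied by `u = j m - vbar m * ρ`
  have hpde_u : ∀ m, ∀ x, ∀ t ∈ Set.Icc (0:ℝ) T,
      derivWithin (fun s => j m x s - vbar m * ρ x s) (Set.Icc 0 T) t =
        (ρ x t * convd d a (fun y => j m y t - vbar m * ρ y t) x
          - (j m x t - vbar m * ρ x t) * convd d a (fun y => ρ y t) x)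
        + ∑ k, pder d k (fun y => b y t * pder d k (fun z => j m z t - vbar m * ρ z t) y) x := by
    intro m x t ht
    have hud : UniqueDiffWithinAt ℝ (Set.Icc 0 T) t := uniqueDiffOn_Icc hT t ht
    have hc : convd d a (fun y => j m y t - vbar m * ρ y t) x =
        convd d a (fun y => j m y t) x - vbar m * convd d a (fun y => ρ y t) x := by
      have c1 := (hsl m t ht).continuous
      have c2 := (hslr t ht).continuous
      unfold convd
      rw [← tint_cmul, ← tint_sub (by fun_prop) (by fun_prop)]
      congr 1
      funext y
      ring
    have hdv : ∑ k, pder d k (fun y => b y t * pder d k (fun z => j m z t - vbar m * ρ z t) y) x =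
        ∑ k, pder d k (fun y => b y t * pder d k (fun z => j m z t) y) x
        - vbar m * ∑ k, pder d k (fun y => b y t * pder d k (fun z => ρ z t) y) x := by
      rw [Finset.mul_sum, ← Finset.sum_sub_distrib]
      refine Finset.sum_congr rfl fun k _ => ?_
      rw [← pder_sub_cmul ((hslb t ht).mul (pder_contDiff (hsl m t ht) k))
        ((hslb t ht).mul (pder_contDiff (hslr t ht) k))]
      congr 1
      funext y
      rw [pder_sub_cmul ((hsl m t ht).of_le h12) ((hslr t ht).of_le h12)]
      ring
    rw [derivWithin_fun_sub (htime (hj1 m) x t ht) ((htime hρ1 x t ht).const_mul _),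
      derivWithin_const_mul _ (htime hρ1 x t ht), hpde_j m x t ht, hpde_rho x t ht, hc, hdv]
    ring
  have hmr : ∀ t ∈ Set.Icc (0:ℝ) T, tint d (fun x => ρ x t) = 1 := by
    intro t ht
    rw [← hmass_rho]
    refine const_of_deriv (f := fun t => tint d (fun x => ρ x t)) (tint_contOn hρ1.continuousOn)
      (fun s hs => ?_) ht
    have hs' : s ∈ Set.Icc 0 T := ⟨hs.1.le, hs.2.le⟩
    have h := tint_hasDeriv hρ1 hs
    simp only [hpde_rho _ s hs'] at h
    have hjc : Continuous fun x => ∑ m : Fin d, pder d m (fun y => j m y s) x :=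
      continuous_finsetSum _ fun k _ => pder_cont ((hsl k s hs').of_le h12) k
    have hrc : Continuous fun x =>
        ∑ m : Fin d, pder d m (fun y => b y s * pder d m (fun z => ρ z s) y) x :=
      continuous_finsetSum _ fun k _ => pder_cont
        ((hslb s hs').mul (pder_contDiff (hslr s hs') k)) k
    have e1 := div_zero_int (fun k y => j k y s) (fun k => (hsl k s hs').of_le h12)
      (fun k => hj_per k s hs')
    have e2 := diff_mean (hslb s hs') (hb_per s hs') (hslr s hs') (hρ_per s hs')
    have e3 := tint_sub hrc hjc
    rw [e1, e2, sub_zero] at e3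
    convert h using 1
    rw [← e3]
    congr 1
    funext x
    ring
  have hmu : ∀ m, ∀ t ∈ Set.Icc (0:ℝ) T, tint d (fun x => j m x t - vbar m * ρ x t) = 0 := by
    intro m t ht
    have h00 : (0:ℝ) ∈ Set.Icc 0 T := ⟨le_rfl, hT.le⟩
    have h0 : tint d (fun x => j m x 0 - vbar m * ρ x 0) = 0 := by
      rw [tint_sub (f := fun x => j m x 0) (g := fun x => vbar m * ρ x 0) (hsl m 0 h00).continuous
        (continuous_const.mul (hslr 0 h00).continuous),
        tint_cmul, hmass_j, hmass_rho]
      ring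
    rw [← h0]
    refine const_of_deriv (f := fun t => tint d (fun x => j m x t - vbar m * ρ x t))
      (tint_contOn (F := fun x t => j m x t - vbar m * ρ x t) (hu1 m).continuousOn)
      (fun s hs => ?_) ht
    have hs' : s ∈ Set.Icc 0 T := ⟨hs.1.le, hs.2.le⟩
    have h := tint_hasDeriv (F := fun x t => j m x t - vbar m * ρ x t) (hu1 m) hs
    simp only [hpde_u m _ s hs'] at h
    rwa [mean_rhs hac ha_even (hslb s hs') (hb_per s hs') (hsu m s hs') (hup m s hs')
      (hslr s hs').continuous] at h
  intro t ht
  rw [Finset.mul_sum]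
  refine Finset.sum_le_sum fun m _ => ?_
  rw [nrmd_sq, nrmd_sq]
  refine gronwall_exp (f := fun t => tint d (fun x =>
    (j m x t - vbar m * ρ x t) * (j m x t - vbar m * ρ x t)))
    (tint_contOn (F := fun x t => (j m x t - vbar m * ρ x t) * (j m x t - vbar m * ρ x t))
      (huu1 m).continuousOn)
    (fun s hs => tint_hasDeriv
      (F := fun x t => (j m x t - vbar m * ρ x t) * (j m x t - vbar m * ρ x t)) (huu1 m) hs)
    (fun s hs => ?_) ht
  have hs' : s ∈ Set.Icc 0 T := ⟨hs.1.le, hs.2.le⟩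
  have hE := energy_ineq hθ hg_cont hg_per (hslb s hs') (hb_per s hs')
    (fun x => hb_nonneg x s hs') (hsu m s hs') (hup m s hs') (hslr s hs').continuous
    (hmu m s hs') (hmr s hs') (hsmall s hs')
  rw [← ha] at hE
  refine le_trans (le_of_eq ?_) hE
  congr 1
  funext x
  have hdx := htime (F := fun x t => j m x t - vbar m * ρ x t) (hu1 m) x s hs'
  rw [derivWithin_fun_mul hdx hdx, hpde_u m x s hs']
  ring
end
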